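/- Let c_puz = (5/2)(π−1). For n ≥ 3 and N ≥ 0, let ν_{n,N}(y) denote the probability that after N steps of the n²−1 puzzle chain started at the identity, the piece with label (0,0) occupies position y ∈ (ℤ/nℤ)², and let D_n(N) = (1/2)·Σ_{y∈(ℤ/nℤ)²} |ν_{n,N}(y) − 1/n²| be the total variation distance of this piece's position from uniform. Then for every compact set K ⊂ (0,∞), sup_{t∈K} |D_n(⌊c_puz n⁴ t⌋) − d_Br(t)| → 0 as n → ∞. -/

import Mathlib

open Finset

/-- The label of the empty square: `(n−1, n−1)`. -/
def emptyLabel (n : ℕ) : ZMod n × ZMod n := (((n - 1 : ℕ) : ZMod n), ((n - 1 : ℕ) : ZMod n))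

/-- The five displacements `{(0,0),(1,0),(−1,0),(0,1),(0,−1)}` of the empty square. -/
def displacements (n : ℕ) : Finset (ZMod n × ZMod n) :=
  {((0 : ZMod n), (0 : ZMod n)), (1, 0), (-1, 0), (0, 1), (0, -1)}

open Classical in
/-- One-step transition probability of the `n²−1` puzzle chain on `Sym((ℤ/nℤ)²)`:
from the arrangement `σ` a displacement `d` is chosen uniformly among the five
possibilities and `σ` is replaced by `τ ∘ σ`, where `τ` is the transposition of the
positions `σ(b)` and `σ(b) + d` of the board (`b = (n−1,n−1)` the label of the empty
square). -/
noncomputable def puzzleStep (n : ℕ) (σ τ : Equiv.Perm (ZMod n × ZMod n)) : ℝ :=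
  (1 / 5 : ℝ) * (((displacements n).filter
    (fun d => τ = Equiv.swap (σ (emptyLabel n)) (σ (emptyLabel n) + d) * σ)).card : ℝ)

/-- The distribution of the `n²−1` puzzle chain after `N` steps, started at the identity
arrangement. -/
noncomputable def puzzleDist (n : ℕ) [NeZero n] : ℕ → Equiv.Perm (ZMod n × ZMod n) → ℝ
  | 0 => fun τ => if τ = 1 then 1 else 0
  | (N + 1) => fun τ => ∑ σ : Equiv.Perm (ZMod n × ZMod n), puzzleDist n N σ * puzzleStep n σ τ

open MeasureTheory

/-- The heat kernel (theta function) on the torus `(ℝ/ℤ)²`: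
`θ_t(x) = Σ_{m ∈ ℤ²} exp(−2π²t‖m‖²) cos(2π m·x)`, the distribution at time `t` of standard
Brownian motion on `(ℝ/ℤ)²` started from `(0,0)`. -/
noncomputable def torusHeatKernel (t : ℝ) (x : ℝ × ℝ) : ℝ :=
  ∑' m : ℤ × ℤ, Real.exp (-2 * Real.pi ^ 2 * t * ((m.1 : ℝ) ^ 2 + (m.2 : ℝ) ^ 2)) *
    Real.cos (2 * Real.pi * ((m.1 : ℝ) * x.1 + (m.2 : ℝ) * x.2))

/-- `d_Br(t)`, the total variation distance to uniformity of Brownian motion on `(ℝ/ℤ)²`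
at time `t`, started at `(0,0)`. -/
noncomputable def dBr (t : ℝ) : ℝ :=
  (1 / 2) * ∫ x in Set.Icc (0 : ℝ) 1 ×ˢ Set.Icc (0 : ℝ) 1, |torusHeatKernel t x - 1|

open Classical in
/-- The probability that after `N` steps of the `n²−1` puzzle chain the piece labeled
`(0,0)` occupies position `y`. -/
noncomputable def pieceDist (n : ℕ) [NeZero n] (N : ℕ) (y : ZMod n × ZMod n) : ℝ :=
  ∑ σ : Equiv.Perm (ZMod n × ZMod n), if σ (0, 0) = y then puzzleDist n N σ else 0

/-- The total variation distance from uniformity of the position of the piece labeled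
`(0,0)` after `N` steps of the `n²−1` puzzle chain. -/
noncomputable def pieceTV (n : ℕ) [NeZero n] (N : ℕ) : ℝ :=
  (1 / 2) * ∑ y : ZMod n × ZMod n, |pieceDist n N y - 1 / (n : ℝ) ^ 2|

/-- The constant `c_puz = (5/2)(π−1)`. -/
noncomputable def cPuz : ℝ := (5 / 2) * (Real.pi - 1)

namespace SinglePiece

/-- The move of the empty square by `d`, seen from the tracked piece: the relative position `z`
of the empty square becomes `z + d`, unless the two pieces are exchanged. -/
def hop {n : ℕ} (d : ZMod n × ZMod n) : Equiv.Perm (ZMod n × ZMod n) :=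
  (Equiv.addRight d).trans (Equiv.swap 0 d)

/-- The factor that a character of the piece's position picks up in a move by `d`. -/
def twist {n : ℕ} (χ : AddChar (ZMod n × ZMod n) ℂ) (d z : ZMod n × ZMod n) : ℂ :=
  if z = -d then χ d else 1

/-- The transfer operator of the pair (piece, empty square), twisted by a character of the
position of the piece. -/
noncomputable def stepOp {n : ℕ} (χ : AddChar (ZMod n × ZMod n) ℂ)
    (f : ZMod n × ZMod n → ℂ) (z : ZMod n × ZMod n) : ℂ :=
  (1 / 5) * ∑ d ∈ displacements n, twist χ d z * f (hop d z)

/-- The expectation of `χ(piece)` on the event that the empty square sits at relative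
position `z`, after `N` steps. -/
noncomputable def pairTransform {n : ℕ} [NeZero n] (χ : AddChar (ZMod n × ZMod n) ℂ) (N : ℕ)
    (z : ZMod n × ZMod n) : ℂ :=
  ∑ σ : Equiv.Perm (ZMod n × ZMod n),
    (puzzleDist n N σ : ℂ) * (if σ (emptyLabel n) - σ 0 = z then χ (σ 0) else 0)

/-- The Dirichlet form of the twisted transfer operator. -/
noncomputable def energy {n : ℕ} [NeZero n] (χ : AddChar (ZMod n × ZMod n) ℂ)
    (f : ZMod n × ZMod n → ℂ) : ℝ :=
  ∑ d ∈ displacements n, ∑ z, ‖f z - twist χ d z * f (hop d z)‖ ^ 2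

section Hop

variable {n : ℕ}

lemma hop_zero_right (d : ZMod n × ZMod n) : hop d 0 = 0 := by simp [hop]

lemma hop_neg_self (d : ZMod n × ZMod n) : hop d (-d) = d := by simp [hop]

lemma hop_of_ne {d z : ZMod n × ZMod n} (h0 : z ≠ 0) (hd : z ≠ -d) : hop d z = z + d := by
  have h1 : z + d ≠ 0 := fun h => hd (eq_neg_of_add_eq_zero_left h)
  have h2 : z + d ≠ d := fun h => h0 (by simpa using h)
  simp [hop, Equiv.swap_apply_of_ne_of_ne h1 h2]

lemma hop_zero_left (z : ZMod n × ZMod n) : hop 0 z = z := by simp [hop]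

lemma hop_neg_hop (d z : ZMod n × ZMod n) : hop (-d) (hop d z) = z := by
  by_cases h0 : z = 0
  · simp [h0, hop_zero_right]
  by_cases hd : z = -d
  · subst hd; rw [hop_neg_self]; simpa using hop_neg_self (-d)
  rw [hop_of_ne h0 hd, hop_of_ne]
  · simp
  · exact fun h => hd (eq_neg_of_add_eq_zero_left h)
  · simpa using h0

lemma hop_symm (d : ZMod n × ZMod n) : (hop d).symm = hop (-d) := by
  ext1 z
  rw [Equiv.symm_apply_eq]
  simpa using (hop_neg_hop (-d) z).symm

lemma hop_eq_self_iff (d z : ZMod n × ZMod n) : hop d z = d ↔ z = -d := by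
  have h := (hop d).apply_eq_iff_eq (x := z) (y := -d)
  rwa [hop_neg_self] at h

lemma twist_zero (χ : AddChar (ZMod n × ZMod n) ℂ) (z : ZMod n × ZMod n) : twist χ 0 z = 1 := by
  simp [twist]

lemma zmod_one_ne_zero (hn : 3 ≤ n) : (1 : ZMod n) ≠ 0 := by
  have : Fact (1 < n) := ⟨by omega⟩
  exact one_ne_zero

lemma zmod_neg_one_ne_one (hn : 3 ≤ n) : (-1 : ZMod n) ≠ 1 := by
  have : Fact (2 < n) := ⟨by omega⟩
  exact ZMod.neg_one_ne_one

lemma emptyLabel_ne_zero (hn : 3 ≤ n) : emptyLabel n ≠ 0 := by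
  have : ((n - 1 : ℕ) : ZMod n) = -1 := by
    rw [Nat.cast_sub (by omega)]; simp
  simp [emptyLabel, this, zmod_one_ne_zero hn]

lemma sum_displacements (hn : 3 ≤ n) {β : Type*} [AddCommMonoid β] (F : ZMod n × ZMod n → β) :
    ∑ d ∈ displacements n, F d
      = F 0 + (F (1, 0) + (F (-1, 0) + (F (0, 1) + F (0, -1)))) := by
  have h1 := zmod_one_ne_zero hn
  have h2 := zmod_neg_one_ne_one hn
  have h3 := h2.symm
  have h4 := h1.symm
  rw [displacements, sum_insert, sum_insert, sum_insert, sum_insert, sum_singleton]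
  · rfl
  all_goals simp [*]

lemma sum_displacements_neg (hn : 3 ≤ n) {β : Type*} [AddCommMonoid β] (F : ZMod n × ZMod n → β) :
    ∑ d ∈ displacements n, F (-d) = ∑ d ∈ displacements n, F d := by
  rw [sum_displacements hn, sum_displacements hn]
  simp only [Prod.neg_mk, neg_zero, neg_neg]
  abel

end Hop

section Chain

variable {n : ℕ} [NeZero n]

lemma sum_puzzleDist_succ_mul (N : ℕ) (F : Equiv.Perm (ZMod n × ZMod n) → ℂ) :
    ∑ τ, (puzzleDist n (N + 1) τ : ℂ) * F τ = ∑ σ, (puzzleDist n N σ : ℂ) *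
      ((1 / 5) * ∑ d ∈ displacements n,
        F (Equiv.swap (σ (emptyLabel n)) (σ (emptyLabel n) + d) * σ)) := by
  classical
  have key : ∀ σ : Equiv.Perm (ZMod n × ZMod n), ∑ τ, (puzzleStep n σ τ : ℂ) * F τ
      = (1 / 5) * ∑ d ∈ displacements n,
        F (Equiv.swap (σ (emptyLabel n)) (σ (emptyLabel n) + d) * σ) := by
    intro σ
    simp only [puzzleStep, card_filter]
    push_cast
    simp only [mul_assoc, ← mul_sum, sum_mul]
    rw [sum_comm]
    simp [apply_ite (Complex.ofReal)]
  simp only [puzzleDist]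
  push_cast
  simp only [sum_mul]
  rw [sum_comm]
  refine sum_congr rfl fun σ _ => ?_
  rw [← key, mul_sum]
  exact sum_congr rfl fun τ _ => by ring

lemma puzzleDist_nonneg (N : ℕ) (σ : Equiv.Perm (ZMod n × ZMod n)) : 0 ≤ puzzleDist n N σ := by
  induction N generalizing σ with
  | zero => simp only [puzzleDist]; split_ifs <;> norm_num
  | succ N ih =>
    simp only [puzzleDist]
    refine sum_nonneg fun τ _ => mul_nonneg (ih τ) ?_
    unfold puzzleStep
    positivity

omit [NeZero n] in
lemma card_displacements (hn : 3 ≤ n) : (displacements n).card = 5 := by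
  rw [card_eq_sum_ones, sum_displacements hn]; rfl

lemma sum_puzzleDist (hn : 3 ≤ n) (N : ℕ) : ∑ σ, puzzleDist n N σ = 1 := by
  induction N with
  | zero => simp [puzzleDist]
  | succ N ih =>
    have := sum_puzzleDist_succ_mul (n := n) N (fun _ => 1)
    simp only [sum_const, card_displacements hn, mul_one] at this
    norm_num at this
    have h2 : ((∑ σ, puzzleDist n (N + 1) σ : ℝ) : ℂ) = (∑ σ, puzzleDist n N σ : ℝ) := by
      push_cast; exact this
    rw [ih] at h2
    exact_mod_cast h2

lemma pairTransform_zero_right (hn : 3 ≤ n) (χ : AddChar (ZMod n × ZMod n) ℂ) (N : ℕ) :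
    pairTransform χ N 0 = 0 := by
  refine sum_eq_zero fun σ _ => ?_
  rw [if_neg, mul_zero]
  rw [sub_eq_zero, σ.apply_eq_iff_eq]
  exact emptyLabel_ne_zero hn

lemma pairTransform_zero_left (χ : AddChar (ZMod n × ZMod n) ℂ) (z : ZMod n × ZMod n) :
    pairTransform χ 0 z = if z = emptyLabel n then 1 else 0 := by
  simp only [pairTransform, puzzleDist]
  rw [sum_eq_single 1 (fun σ _ h => by simp [h]) (by simp)]
  simp [eq_comm]

lemma pairTransform_succ (hn : 3 ≤ n) (χ : AddChar (ZMod n × ZMod n) ℂ) (N : ℕ) :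
    pairTransform χ (N + 1) = stepOp χ (pairTransform χ N) := by
  funext z
  unfold stepOp
  rw [pairTransform, sum_puzzleDist_succ_mul]
  simp only [pairTransform, mul_sum]
  rw [sum_comm, ← sum_displacements_neg hn]
  refine sum_congr rfl fun d _ => sum_congr rfl fun σ _ => ?_
  have hb : σ (emptyLabel n) ≠ σ 0 := by
    rw [Ne, σ.apply_eq_iff_eq]; exact emptyLabel_ne_zero hn
  set x := σ (emptyLabel n)
  set y := σ 0
  have hxy : x - y ≠ 0 := sub_ne_zero.2 hb
  have e1 : (Equiv.swap x (x + -d) * σ) (emptyLabel n) = x + -d := by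
    rw [Equiv.Perm.mul_apply]; exact Equiv.swap_apply_left _ _
  have e2 : (Equiv.swap x (x + -d) * σ) 0 = Equiv.swap x (x + -d) y := Equiv.Perm.mul_apply _ _ _
  rw [e1, e2]
  have hz : (x - y = hop d z) ↔ hop (-d) (x - y) = z := by
    rw [← hop_symm, Equiv.symm_apply_eq]
  simp only [hz]
  by_cases hd : x - y = d
  · have hy : y = x - d := by rw [← hd]; abel
    have h1 : Equiv.swap x (x + -d) y = x := by
      rw [hy, ← sub_eq_add_neg]; exact Equiv.swap_apply_right _ _
    rw [h1, hd]
    have h2 : hop (-d) d = -d := by simpa using hop_neg_self (-d)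
    rw [h2]
    have h3 : x + -d - x = -d := by abel
    rw [h3]
    by_cases h4 : -d = z
    · rw [if_pos h4, if_pos h4, twist, if_pos h4.symm]
      have : χ x = χ d * χ y := by rw [← AddChar.map_add_eq_mul, hy]; congr 1; abel
      rw [this]; ring
    · simp [h4]
  · have h1 : Equiv.swap x (x + -d) y = y := by
      refine Equiv.swap_apply_of_ne_of_ne hb.symm fun h => hd ?_
      rw [h]; abel
    rw [h1, hop_of_ne hxy (by simpa using hd)]
    have h3 : x + -d - y = x - y + -d := by abel
    rw [h3]
    by_cases h4 : x - y + -d = z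
    · rw [if_pos h4, twist, if_neg]
      · ring
      · intro h
        apply hxy
        rw [h] at h4
        simpa using h4
    · simp [h4]

lemma sum_norm_pairTransform_le (hn : 3 ≤ n) (χ : AddChar (ZMod n × ZMod n) ℂ) (N : ℕ) :
    ∑ z, ‖pairTransform χ N z‖ ≤ 1 := by
  classical
  calc ∑ z, ‖pairTransform χ N z‖
      ≤ ∑ z, ∑ σ : Equiv.Perm (ZMod n × ZMod n),
          puzzleDist n N σ * (if σ (emptyLabel n) - σ 0 = z then 1 else 0) := by
        refine sum_le_sum fun z _ => (norm_sum_le _ _).trans (sum_le_sum fun σ _ => ?_)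
        rw [norm_mul, Complex.norm_real, Real.norm_of_nonneg (puzzleDist_nonneg _ _)]
        refine mul_le_mul_of_nonneg_left ?_ (puzzleDist_nonneg _ _)
        split_ifs
        · exact (AddChar.norm_apply χ _).le
        · simp
    _ = 1 := by
        rw [sum_comm]
        simp [sum_puzzleDist hn]

lemma sum_pairTransform (χ : AddChar (ZMod n × ZMod n) ℂ) (N : ℕ) :
    ∑ z, pairTransform χ N z
      = ∑ σ : Equiv.Perm (ZMod n × ZMod n), (puzzleDist n N σ : ℂ) * χ (σ 0) := by
  simp only [pairTransform]
  rw [sum_comm]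
  simp

lemma norm_twist (χ : AddChar (ZMod n × ZMod n) ℂ) (d z : ZMod n × ZMod n) :
    ‖twist χ d z‖ = 1 := by
  unfold twist
  split_ifs
  · exact AddChar.norm_apply χ _
  · simp

lemma sum_norm_sq_hop (χ : AddChar (ZMod n × ZMod n) ℂ) (f : ZMod n × ZMod n → ℂ)
    (d : ZMod n × ZMod n) : ∑ z, ‖twist χ d z * f (hop d z)‖ ^ 2 = ∑ z, ‖f z‖ ^ 2 := by
  simp only [norm_mul, norm_twist, one_mul]
  exact Equiv.sum_comp (hop d) fun z => ‖f z‖ ^ 2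

/-- The transfer operator decreases the `ℓ²` norm by a multiple of the energy. -/
lemma sum_norm_sq_stepOp_le (hn : 3 ≤ n) (χ : AddChar (ZMod n × ZMod n) ℂ)
    (f : ZMod n × ZMod n → ℂ) :
    ∑ z, ‖stepOp χ f z‖ ^ 2 ≤ ∑ z, ‖f z‖ ^ 2 - (1 / 25) * energy χ f := by
  have pw : ∀ a b c d e : ℂ, ‖(1 / 5) * (a + (b + (c + (d + e))))‖ ^ 2
      ≤ (1 / 5) * (‖a‖ ^ 2 + (‖b‖ ^ 2 + (‖c‖ ^ 2 + (‖d‖ ^ 2 + ‖e‖ ^ 2))))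
        - (1 / 25) * (‖a - a‖ ^ 2 + (‖a - b‖ ^ 2 + (‖a - c‖ ^ 2 + (‖a - d‖ ^ 2
          + ‖a - e‖ ^ 2)))) := by
    intro a b c d e
    simp only [Complex.sq_norm, Complex.normSq_apply, Complex.mul_re, Complex.mul_im,
      Complex.add_re, Complex.add_im, Complex.sub_re, Complex.sub_im]
    norm_num
    nlinarith [sq_nonneg (b.re - c.re), sq_nonneg (b.re - d.re), sq_nonneg (b.re - e.re),
      sq_nonneg (c.re - d.re), sq_nonneg (c.re - e.re), sq_nonneg (d.re - e.re),
      sq_nonneg (b.im - c.im), sq_nonneg (b.im - d.im), sq_nonneg (b.im - e.im),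
      sq_nonneg (c.im - d.im), sq_nonneg (c.im - e.im), sq_nonneg (d.im - e.im)]
  have h1 : ∀ z, ‖stepOp χ f z‖ ^ 2
      ≤ (1 / 5) * ∑ d ∈ displacements n, ‖twist χ d z * f (hop d z)‖ ^ 2
        - (1 / 25) * ∑ d ∈ displacements n, ‖f z - twist χ d z * f (hop d z)‖ ^ 2 := by
    intro z
    unfold stepOp
    simp only [sum_displacements hn, twist_zero, hop_zero_left, one_mul]
    exact pw _ _ _ _ _
  refine (sum_le_sum fun z _ => h1 z).trans (le_of_eq ?_)
  rw [sum_sub_distrib, ← mul_sum, ← mul_sum, sum_comm]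
  simp only [sum_norm_sq_hop, sum_const, card_displacements hn, energy]
  rw [sum_comm (s := univ)]
  simp

/-- The energy as a quadratic form of `1 - stepOp χ`. -/
lemma energy_eq (hn : 3 ≤ n) (χ : AddChar (ZMod n × ZMod n) ℂ) (f : ZMod n × ZMod n → ℂ) :
    energy χ f = 10 * (∑ z, (starRingEnd ℂ) (f z) * (f z - stepOp χ f z)).re := by
  have pw : ∀ a b : ℂ, ((starRingEnd ℂ) a * (a - b)).re
      = (1 / 2) * (‖a‖ ^ 2 - ‖b‖ ^ 2 + ‖a - b‖ ^ 2) := by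
    intro a b
    simp only [Complex.sq_norm, Complex.normSq_apply, Complex.mul_re, Complex.sub_re,
      Complex.sub_im, Complex.conj_re, Complex.conj_im]
    ring
  have h1 : ∀ z, f z - stepOp χ f z
      = (1 / 5) * ∑ d ∈ displacements n, (f z - twist χ d z * f (hop d z)) := by
    intro z
    rw [sum_sub_distrib, sum_const, card_displacements hn, stepOp, nsmul_eq_mul]
    push_cast
    ring
  have h2 : ∀ z, ((starRingEnd ℂ) (f z) * (f z - stepOp χ f z)).re
      = (1 / 10) * ∑ d ∈ displacements n, (‖f z‖ ^ 2 - ‖twist χ d z * f (hop d z)‖ ^ 2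
        + ‖f z - twist χ d z * f (hop d z)‖ ^ 2) := by
    intro z
    rw [h1, mul_left_comm, mul_sum, show (1 / 5 : ℂ) = ((1 / 5 : ℝ) : ℂ) by push_cast; rfl,
      Complex.re_ofReal_mul, Complex.re_sum]
    simp only [pw]
    rw [← mul_sum]
    ring
  rw [Complex.re_sum]
  simp only [h2]
  rw [← mul_sum, sum_comm]
  simp only [sum_add_distrib, sum_sub_distrib, sum_norm_sq_hop, energy]
  simp

/-- The transpose of the transfer operator is the operator for the inverse character. -/
lemma sum_mul_stepOp (hn : 3 ≤ n) (χ : AddChar (ZMod n × ZMod n) ℂ)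
    (w f : ZMod n × ZMod n → ℂ) :
    ∑ z, w z * stepOp χ f z = ∑ z, stepOp χ⁻¹ w z * f z := by
  simp only [stepOp, mul_sum, sum_mul]
  rw [sum_comm, sum_comm (s := univ), ← sum_displacements_neg hn]
  refine sum_congr rfl fun d _ => ?_
  rw [← Equiv.sum_comp (hop d)]
  refine sum_congr rfl fun z _ => ?_
  rw [hop_neg_hop]
  have : twist χ (-d) (hop d z) = twist χ⁻¹ d z := by
    simp [twist, hop_eq_self_iff]
  rw [this]
  ring

end Chain

end SinglePiece

namespace SinglePiece

variable {n : ℕ} [NeZero n]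

lemma norm_sub_sq_le_sum_zmod (g : ZMod n → ℂ) (a b : ZMod n) :
    ‖g a - g b‖ ^ 2 ≤ n * ∑ i, ‖g i - g (i + 1)‖ ^ 2 := by
  obtain ⟨m, hm, rfl⟩ : ∃ m : ℕ, m < n ∧ b = a + m :=
    ⟨(b - a).val, ZMod.val_lt _, by simp⟩
  have h1 : g a - g (a + m) = ∑ j ∈ range m, (g (a + j) - g (a + j + 1)) := by
    have := sum_range_sub' (fun j : ℕ => g (a + j)) m
    simp only [Nat.cast_zero, add_zero, Nat.cast_add, Nat.cast_one, ← add_assoc] at this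
    exact this.symm
  have h2 : ∑ j ∈ range m, ‖g (a + j) - g (a + j + 1)‖ ^ 2 ≤ ∑ i, ‖g i - g (i + 1)‖ ^ 2 := by
    have hinj : Set.InjOn (fun j : ℕ => a + (j : ZMod n)) (range m) := by
      intro j hj k hk h
      have hj' : j < n := by simp at hj; omega
      have hk' : k < n := by simp at hk; omega
      have h' : (j : ZMod n) = k := by simpa using h
      have := congrArg ZMod.val h'
      rwa [ZMod.val_cast_of_lt hj', ZMod.val_cast_of_lt hk'] at this
    rw [← sum_image (f := fun i => ‖g i - g (i + 1)‖ ^ 2) hinj]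
    exact sum_le_sum_of_subset_of_nonneg (subset_univ _) fun _ _ _ => by positivity
  rw [h1]
  calc ‖∑ j ∈ range m, (g (a + j) - g (a + j + 1))‖ ^ 2
      ≤ (∑ j ∈ range m, ‖g (a + j) - g (a + j + 1)‖) ^ 2 := by
        gcongr; exact norm_sum_le _ _
    _ ≤ (range m).card * ∑ j ∈ range m, ‖g (a + j) - g (a + j + 1)‖ ^ 2 :=
        sq_sum_le_card_mul_sum_sq
    _ ≤ n * ∑ i, ‖g i - g (i + 1)‖ ^ 2 := by
        rw [card_range]
        gcongr

lemma energy_nonneg (χ : AddChar (ZMod n × ZMod n) ℂ) (f : ZMod n × ZMod n → ℂ) :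
    0 ≤ energy χ f := sum_nonneg fun _ _ => sum_nonneg fun _ _ => by positivity

lemma sum_le_energy (χ : AddChar (ZMod n × ZMod n) ℂ) (f : ZMod n × ZMod n → ℂ)
    {d : ZMod n × ZMod n} (hd : d ∈ displacements n) :
    ∑ z, ‖f z - twist χ d z * f (hop d z)‖ ^ 2 ≤ energy χ f :=
  single_le_sum (f := fun d => ∑ z, ‖f z - twist χ d z * f (hop d z)‖ ^ 2)
    (fun _ _ => sum_nonneg fun _ _ => by positivity) hd

lemma norm_sub_twist_le (χ : AddChar (ZMod n × ZMod n) ℂ) (f : ZMod n × ZMod n → ℂ)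
    {d : ZMod n × ZMod n} (hd : d ∈ displacements n) (z : ZMod n × ZMod n) :
    ‖f z - twist χ d z * f (hop d z)‖ ≤ √(energy χ f) := by
  refine Real.le_sqrt_of_sq_le ((single_le_sum
    (f := fun z => ‖f z - twist χ d z * f (hop d z)‖ ^ 2) (fun _ _ => by positivity)
    (mem_univ z)).trans (sum_le_energy χ f hd))

lemma norm_sub_add_le (χ : AddChar (ZMod n × ZMod n) ℂ) (f : ZMod n × ZMod n → ℂ)
    {d : ZMod n × ZMod n} (hd : d ∈ displacements n) {z : ZMod n × ZMod n} (hz : z ≠ 0)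
    (hzd : z ≠ -d) : ‖f z - f (z + d)‖ ≤ √(energy χ f) := by
  have := norm_sub_twist_le χ f hd z
  rwa [hop_of_ne hz hzd, twist, if_neg hzd, one_mul] at this

lemma norm_sub_row_le (χ : AddChar (ZMod n × ZMod n) ℂ) (f : ZMod n × ZMod n → ℂ)
    {j : ZMod n} (hj : j ≠ 0) (a b : ZMod n) :
    ‖f (a, j) - f (b, j)‖ ≤ √(n * energy χ f) := by
  refine Real.le_sqrt_of_sq_le ((norm_sub_sq_le_sum_zmod (fun i => f (i, j)) a b).trans ?_)
  gcongr
  refine le_trans ?_ (sum_le_energy χ f (d := (1, 0)) (by simp [displacements]))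
  rw [Fintype.sum_prod_type]
  refine sum_le_sum fun i _ => ?_
  refine le_trans (le_of_eq ?_) (single_le_sum (fun _ _ => by positivity) (mem_univ j))
  have h0 : ((i, j) : ZMod n × ZMod n) ≠ 0 := by simp [hj]
  have h1 : ((i, j) : ZMod n × ZMod n) ≠ -(1, 0) := by simp [hj]
  rw [hop_of_ne h0 h1, twist, if_neg h1]
  simp

lemma norm_sub_col_le (χ : AddChar (ZMod n × ZMod n) ℂ) (f : ZMod n × ZMod n → ℂ)
    {i : ZMod n} (hi : i ≠ 0) (a b : ZMod n) :
    ‖f (i, a) - f (i, b)‖ ≤ √(n * energy χ f) := by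
  refine Real.le_sqrt_of_sq_le ((norm_sub_sq_le_sum_zmod (fun j => f (i, j)) a b).trans ?_)
  gcongr
  refine le_trans ?_ (sum_le_energy χ f (d := (0, 1)) (by simp [displacements]))
  rw [Fintype.sum_prod_type_right]
  refine sum_le_sum fun j _ => ?_
  refine le_trans (le_of_eq ?_) (single_le_sum (fun _ _ => by positivity) (mem_univ i))
  have h0 : ((i, j) : ZMod n × ZMod n) ≠ 0 := by simp [hi]
  have h1 : ((i, j) : ZMod n × ZMod n) ≠ -(0, 1) := by simp [hi]
  rw [hop_of_ne h0 h1, twist, if_neg h1]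
  simp

/-- The oscillation of a function off the origin is controlled by its energy. -/
lemma norm_sub_le_energy (hn : 3 ≤ n) (χ : AddChar (ZMod n × ZMod n) ℂ)
    (f : ZMod n × ZMod n → ℂ) {x y : ZMod n × ZMod n} (hx : x ≠ 0) (hy : y ≠ 0) :
    ‖f x - f y‖ ≤ 4 * √(n * energy χ f) := by
  have h1 := zmod_one_ne_zero hn
  have key : ∀ x : ZMod n × ZMod n, x ≠ 0 → ‖f x - f (1, 1)‖ ≤ 2 * √(n * energy χ f) := by
    rintro ⟨i, j⟩ hx
    by_cases hj : j = 0
    · have hi : i ≠ 0 := by rintro rfl; exact hx (by simp [hj])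
      have := norm_sub_le_norm_sub_add_norm_sub (f (i, j)) (f (i, 1)) (f (1, 1))
      linarith [norm_sub_col_le χ f hi j 1, norm_sub_row_le χ f h1 i 1]
    · have := norm_sub_le_norm_sub_add_norm_sub (f (i, j)) (f (1, j)) (f (1, 1))
      linarith [norm_sub_row_le χ f hj i 1, norm_sub_col_le χ f h1 j 1]
  have := norm_sub_le_norm_sub_add_norm_sub (f x) (f (1, 1)) (f y)
  rw [norm_sub_rev (f (1, 1))] at this
  linarith [key x hx, key y hy]

lemma energy_ge_or_norm_ge (hn : 3 ≤ n) (χ : AddChar (ZMod n × ZMod n) ℂ)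
    (f : ZMod n × ZMod n → ℂ) (hf : f 0 = 0) :
    (∑ z, ‖f z‖ ^ 2) / (256 * n ^ 3) ≤ energy χ f ∨
      ∀ z ≠ 0, 3 / 4 * (√(∑ z, ‖f z‖ ^ 2) / n) ≤ ‖f z‖ := by
  set Y := ∑ z, ‖f z‖ ^ 2 with hY
  have hn0 : (0 : ℝ) < n := by exact_mod_cast (by omega : 0 < n)
  rw [or_iff_not_imp_left, not_le]
  intro hE z hz
  have hE0 := energy_nonneg χ f
  have hYpos : 0 < Y := by
    have : 0 < Y / (256 * n ^ 3) := hE0.trans_lt hE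
    exact (div_pos_iff_of_pos_right (by positivity)).1 this
  have hosc : √(n * energy χ f) ≤ √Y / n / 16 := by
    refine Real.sqrt_le_iff.2 ⟨by positivity, ?_⟩
    rw [div_pow, div_pow, Real.sq_sqrt hYpos.le]
    have := (lt_div_iff₀ (by positivity)).1 hE
    rw [div_div, le_div_iff₀ (by positivity)]
    nlinarith
  obtain ⟨z₁, hz₁⟩ : ∃ z₁, Y / n ^ 2 ≤ ‖f z₁‖ ^ 2 := by
    obtain ⟨z₁, -, h⟩ := exists_le_of_sum_le (s := (univ : Finset (ZMod n × ZMod n)))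
      (f := fun _ => Y / n ^ 2) (g := fun z => ‖f z‖ ^ 2) univ_nonempty (by
        simp only [sum_const, card_univ, Fintype.card_prod, ZMod.card, nsmul_eq_mul]
        rw [← hY]
        push_cast
        refine le_of_eq ?_
        field_simp)
    exact ⟨z₁, h⟩
  have hz₁0 : z₁ ≠ 0 := by
    rintro rfl
    rw [hf, norm_zero] at hz₁
    have : 0 < Y / n ^ 2 := by positivity
    norm_num at hz₁
    linarith
  have h1 : √Y / n ≤ ‖f z₁‖ := by
    rw [← abs_of_nonneg (norm_nonneg (f z₁))]
    refine le_trans (le_of_eq ?_) (Real.sqrt_le_sqrt hz₁ |>.trans_eq (Real.sqrt_sq_eq_abs _))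
    rw [Real.sqrt_div hYpos.le, Real.sqrt_sq hn0.le]
  have h2 := norm_sub_le_energy hn χ f hz₁0 hz
  have h3 := norm_sub_norm_le (f z₁) (f z)
  linarith

lemma norm_one_sub_mul_le (hn : 3 ≤ n) (χ : AddChar (ZMod n × ZMod n) ℂ)
    (f : ZMod n × ZMod n → ℂ) {d : ZMod n × ZMod n} (hd : d = (1, 0) ∨ d = (0, 1)) :
    ‖1 - χ d‖ * ‖f d‖ ≤ 5 * √(energy χ f) := by
  have h1 := zmod_one_ne_zero hn
  have h2 := zmod_neg_one_ne_one hn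
  have hD : d ∈ displacements n := by rcases hd with rfl | rfl <;> simp [displacements]
  have e0 : ‖f (-d) - χ d * f d‖ ≤ √(energy χ f) := by
    have := norm_sub_twist_le χ f hD (-d)
    rwa [hop_neg_self, twist, if_pos rfl] at this
  have e1 : ‖f d - f (-d)‖ ≤ 4 * √(energy χ f) := by
    have path : ∀ a b c d e : ℂ, ‖a - e‖ ≤ ‖a - b‖ + ‖b - c‖ + ‖c - d‖ + ‖d - e‖ := by
      intro a b c d e
      have e3 := norm_sub_le_norm_sub_add_norm_sub a b e
      have e4 := norm_sub_le_norm_sub_add_norm_sub b c e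
      have e5 := norm_sub_le_norm_sub_add_norm_sub c d e
      linarith
    rcases hd with rfl | rfl
    · have a1 := norm_sub_add_le χ f (d := (0, 1)) (z := (1, 0)) (by simp [displacements])
        (by simp [h1]) (by simp [h1])
      have a2 := norm_sub_add_le χ f (d := (-1, 0)) (z := (1, 1)) (by simp [displacements])
        (by simp [h1]) (by simp [h1])
      have a3 := norm_sub_add_le χ f (d := (-1, 0)) (z := (0, 1)) (by simp [displacements])
        (by simp [h1]) (by simp [h1])
      have a4 := norm_sub_add_le χ f (d := (0, -1)) (z := (-1, 1)) (by simp [displacements])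
        (by simp [h1]) (by simp [h1])
      have := path (f (1, 0)) (f (1, 1)) (f (0, 1)) (f (-1, 1)) (f (-1, 0))
      simp only [Prod.mk_add_mk, add_zero, zero_add, add_neg_cancel] at a1 a2 a3 a4
      simp only [Prod.neg_mk, neg_zero]
      linarith
    · have a1 := norm_sub_add_le χ f (d := (1, 0)) (z := (0, 1)) (by simp [displacements])
        (by simp [h1]) (by simp [h1])
      have a2 := norm_sub_add_le χ f (d := (0, -1)) (z := (1, 1)) (by simp [displacements])
        (by simp [h1]) (by simp [h1])
      have a3 := norm_sub_add_le χ f (d := (0, -1)) (z := (1, 0)) (by simp [displacements])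
        (by simp [h1]) (by simp [h1])
      have a4 := norm_sub_add_le χ f (d := (-1, 0)) (z := (1, -1)) (by simp [displacements])
        (by simp [h1]) (by simp [h1])
      have := path (f (0, 1)) (f (1, 1)) (f (1, 0)) (f (1, -1)) (f (0, -1))
      simp only [Prod.mk_add_mk, add_zero, zero_add, add_neg_cancel] at a1 a2 a3 a4
      simp only [Prod.neg_mk, neg_zero]
      linarith
  rw [← norm_mul, show (1 - χ d) * f d = (f d - f (-d)) + (f (-d) - χ d * f d) by ring]
  linarith [norm_add_le (f d - f (-d)) (f (-d) - χ d * f d)]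

/-- A Poincaré inequality for the twisted Dirichlet form. -/
lemma mul_sum_le_energy (hn : 3 ≤ n) (χ : AddChar (ZMod n × ZMod n) ℂ)
    (f : ZMod n × ZMod n → ℂ) (hf : f 0 = 0) {d : ZMod n × ZMod n}
    (hd : d = (1, 0) ∨ d = (0, 1)) {k : ℝ} (hk0 : 0 ≤ k) (hkn : k ≤ n) (hk : k ≤ k ^ 2)
    (hχ : 4 * k / n ≤ ‖1 - χ d‖) :
    k / (256 * n ^ 4) * ∑ z, ‖f z‖ ^ 2 ≤ energy χ f := by
  have hn0 : (0 : ℝ) < n := by exact_mod_cast (by omega : 0 < n)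
  have hY : 0 ≤ ∑ z, ‖f z‖ ^ 2 := sum_nonneg fun _ _ => by positivity
  rcases energy_ge_or_norm_ge hn χ f hf with h | h
  · refine le_trans ?_ h
    rw [div_mul_eq_mul_div, div_le_div_iff₀ (by positivity) (by positivity)]
    have : 0 ≤ (∑ z, ‖f z‖ ^ 2) * (256 * n ^ 3) := by positivity
    nlinarith
  · have h1 := zmod_one_ne_zero hn
    have hd0 : d ≠ 0 := by rcases hd with rfl | rfl <;> simp [h1]
    have h2 := norm_one_sub_mul_le hn χ f hd
    have h3 := mul_le_mul hχ (h d hd0) (by positivity) (norm_nonneg _)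
    have h4 : 3 * k / n ^ 2 * √(∑ z, ‖f z‖ ^ 2) ≤ 5 * √(energy χ f) := by
      refine le_trans (le_of_eq ?_) (h3.trans h2)
      field_simp
    have h5 := pow_le_pow_left₀ (by positivity) h4 2
    rw [mul_pow, mul_pow, Real.sq_sqrt hY, Real.sq_sqrt (energy_nonneg χ f)] at h5
    have h6 : k / (256 * n ^ 4) ≤ (3 * k / n ^ 2) ^ 2 / 25 := by
      rw [div_pow, div_div, div_le_div_iff₀ (by positivity) (by positivity)]
      have : 0 < (n : ℝ) ^ 4 := by positivity
      nlinarith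
    have h7 := mul_le_mul_of_nonneg_right h6 hY
    linarith

lemma sum_norm_sq_pairTransform_zero (χ : AddChar (ZMod n × ZMod n) ℂ) :
    ∑ z, ‖pairTransform χ 0 z‖ ^ 2 = 1 := by
  simp only [pairTransform_zero_left]
  rw [sum_eq_single (emptyLabel n) (fun _ _ h => by simp [h]) (by simp)]
  simp

/-- The empty square mixes: the `ℓ²` norm of the pair transform decays to order `1 / n`. -/
lemma sum_norm_sq_pairTransform_le (hn : 3 ≤ n) (χ : AddChar (ZMod n × ZMod n) ℂ) (N : ℕ) :
    ∑ z, ‖pairTransform χ N z‖ ^ 2 ≤ 4 / n ^ 2 + (1 - 1 / (6400 * n ^ 3)) ^ N := by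
  have hn0 : (0 : ℝ) < n := by exact_mod_cast (by omega : 0 < n)
  have hn3 : (3 : ℝ) ≤ n := by exact_mod_cast hn
  have hρ : 1 / (6400 * (n : ℝ) ^ 3) ≤ 1 := by
    rw [div_le_one (by positivity)]
    have : (1 : ℝ) ≤ n ^ 3 := one_le_pow₀ (by linarith)
    linarith
  have hρ0 : 0 ≤ 1 - 1 / (6400 * (n : ℝ) ^ 3) := by linarith
  induction N with
  | zero =>
    rw [sum_norm_sq_pairTransform_zero, pow_zero]
    have : (0 : ℝ) ≤ 4 / n ^ 2 := by positivity
    linarith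
  | succ N ih =>
    rw [pairTransform_succ hn]
    have h1 := sum_norm_sq_stepOp_le hn χ (pairTransform χ N)
    have hE := energy_nonneg χ (pairTransform χ N)
    set Y := ∑ z, ‖pairTransform χ N z‖ ^ 2
    have hY : 0 ≤ Y := sum_nonneg fun _ _ => by positivity
    rcases energy_ge_or_norm_ge hn χ _ (pairTransform_zero_right hn χ N) with h | h
    · have h2 : ∑ z, ‖stepOp χ (pairTransform χ N) z‖ ^ 2
          ≤ (1 - 1 / (6400 * n ^ 3)) * Y := by
        refine h1.trans ?_
        have : Y / (256 * n ^ 3) = 25 * (1 / (6400 * n ^ 3) * Y) := by field_simp; ring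
        rw [this] at h
        linarith
      refine h2.trans ((mul_le_mul_of_nonneg_left ih hρ0).trans ?_)
      rw [mul_add, pow_succ' _ N]
      have : (1 - 1 / (6400 * (n : ℝ) ^ 3)) * (4 / n ^ 2) ≤ 4 / n ^ 2 := by
        refine mul_le_of_le_one_left (by positivity) ?_
        have : 0 ≤ 1 / (6400 * (n : ℝ) ^ 3) := by positivity
        linarith
      linarith
    · have h2 : (n ^ 2 - 1) * (3 / 4 * (√Y / n)) ≤ 1 := by
        refine le_trans ?_ (sum_norm_pairTransform_le hn χ N)
        rw [← add_sum_erase univ _ (mem_univ (0 : ZMod n × ZMod n))]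
        have := card_nsmul_le_sum (univ.erase (0 : ZMod n × ZMod n))
          (fun z => ‖pairTransform χ N z‖) (3 / 4 * (√Y / n))
          fun z hz => h z (ne_of_mem_erase hz)
        rw [card_erase_of_mem (mem_univ _), card_univ, Fintype.card_prod, ZMod.card,
          nsmul_eq_mul, Nat.cast_sub (by nlinarith)] at this
        push_cast at this
        rw [← sq] at this
        exact this.trans (le_add_of_nonneg_left (norm_nonneg _))
      have h3 : √Y ≤ 2 / n := by
        rw [le_div_iff₀ hn0]
        have e : (n ^ 2 - 1) * (3 / 4 * (√Y / n)) = (√Y * n) * (3 / 4 * (1 - 1 / n ^ 2)) := by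
          field_simp
        rw [e] at h2
        have : 1 / (n : ℝ) ^ 2 ≤ 1 / 9 := by
          apply one_div_le_one_div_of_le (by norm_num); nlinarith
        have h0 : 0 ≤ √Y * n := by positivity
        nlinarith
      have h4 : Y ≤ 4 / n ^ 2 := by
        have := pow_le_pow_left₀ (Real.sqrt_nonneg _) h3 2
        rw [Real.sq_sqrt hY, div_pow] at this
        linarith
      have := pow_nonneg hρ0 (N + 1)
      linarith

lemma sum_norm_sq_pairTransform_add_le (hn : 3 ≤ n) (χ : AddChar (ZMod n × ZMod n) ℂ)
    {d : ZMod n × ZMod n} (hd : d = (1, 0) ∨ d = (0, 1)) {k : ℝ} (hk0 : 0 ≤ k) (hkn : k ≤ n)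
    (hk : k ≤ k ^ 2) (hχ : 4 * k / n ≤ ‖1 - χ d‖) (M N : ℕ) :
    ∑ z, ‖pairTransform χ (M + N) z‖ ^ 2
      ≤ (1 - k / (6400 * n ^ 4)) ^ N * ∑ z, ‖pairTransform χ M z‖ ^ 2 := by
  have hn0 : (0 : ℝ) < n := by exact_mod_cast (by omega : 0 < n)
  have hρ : k / (6400 * (n : ℝ) ^ 4) ≤ 1 := by
    rw [div_le_one (by positivity)]
    have : (1 : ℝ) ≤ n ^ 3 := one_le_pow₀ (by exact_mod_cast (by omega : 1 ≤ n))
    nlinarith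
  induction N with
  | zero => simp
  | succ N ih =>
    rw [← add_assoc, pairTransform_succ hn]
    refine (sum_norm_sq_stepOp_le hn χ _).trans ?_
    have h := mul_sum_le_energy hn χ _ (pairTransform_zero_right hn χ (M + N)) hd hk0 hkn hk hχ
    set Y := ∑ z, ‖pairTransform χ (M + N) z‖ ^ 2
    have : k / (256 * n ^ 4) * Y = 25 * (k / (6400 * n ^ 4) * Y) := by field_simp; ring
    rw [this] at h
    rw [pow_succ', mul_assoc]
    refine le_trans ?_ (mul_le_mul_of_nonneg_left ih (by linarith))
    linarith

lemma norm_sum_sq_le (f : ZMod n × ZMod n → ℂ) :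
    ‖∑ z, f z‖ ^ 2 ≤ n ^ 2 * ∑ z, ‖f z‖ ^ 2 := by
  calc ‖∑ z, f z‖ ^ 2 ≤ (∑ z, ‖f z‖) ^ 2 := by gcongr; exact norm_sum_le _ _
    _ ≤ (univ : Finset (ZMod n × ZMod n)).card * ∑ z, ‖f z‖ ^ 2 := sq_sum_le_card_mul_sum_sq
    _ = n ^ 2 * ∑ z, ‖f z‖ ^ 2 := by
        rw [card_univ, Fintype.card_prod, ZMod.card]; push_cast; ring

/-- Decay of the Fourier coefficients of the position of the piece. -/
lemma norm_sum_pairTransform_sq_le (hn : 3 ≤ n) (χ : AddChar (ZMod n × ZMod n) ℂ)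
    {d : ZMod n × ZMod n} (hd : d = (1, 0) ∨ d = (0, 1)) {k : ℝ} (hk0 : 0 ≤ k) (hkn : k ≤ n)
    (hk : k ≤ k ^ 2) (hχ : 4 * k / n ≤ ‖1 - χ d‖) (M N : ℕ) :
    ‖∑ z, pairTransform χ (M + N) z‖ ^ 2
      ≤ (1 - k / (6400 * n ^ 4)) ^ N * (4 + n ^ 2 * (1 - 1 / (6400 * n ^ 3)) ^ M) := by
  have hn0 : (0 : ℝ) < n := by exact_mod_cast (by omega : 0 < n)
  have hρ : k / (6400 * (n : ℝ) ^ 4) ≤ 1 := by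
    rw [div_le_one (by positivity)]
    have : (1 : ℝ) ≤ n ^ 3 := one_le_pow₀ (by exact_mod_cast (by omega : 1 ≤ n))
    nlinarith
  refine (norm_sum_sq_le _).trans ?_
  have h1 := sum_norm_sq_pairTransform_add_le hn χ hd hk0 hkn hk hχ M N
  have h2 := sum_norm_sq_pairTransform_le hn χ M
  calc (n : ℝ) ^ 2 * ∑ z, ‖pairTransform χ (M + N) z‖ ^ 2
      ≤ n ^ 2 * ((1 - k / (6400 * n ^ 4)) ^ N
          * (4 / n ^ 2 + (1 - 1 / (6400 * n ^ 3)) ^ M)) := by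
        refine mul_le_mul_of_nonneg_left (h1.trans ?_) (by positivity)
        exact mul_le_mul_of_nonneg_left h2 (pow_nonneg (by linarith) _)
    _ = _ := by field_simp

lemma norm_sub_average_le (hn : 3 ≤ n) (χ : AddChar (ZMod n × ZMod n) ℂ)
    (f : ZMod n × ZMod n → ℂ) (hf : f 0 = 0) {p : ZMod n × ZMod n} (hp : p ≠ 0) :
    ‖f p - (∑ z, f z) / ((n : ℂ) ^ 2 - 1)‖ ≤ 4 * √(n * energy χ f) := by
  have hn3 : (3 : ℝ) ≤ n := by exact_mod_cast hn
  have hpos : (0 : ℝ) < n ^ 2 - 1 := by nlinarith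
  have hc : ((univ.erase (0 : ZMod n × ZMod n)).card : ℝ) = n ^ 2 - 1 := by
    rw [card_erase_of_mem (mem_univ _), card_univ, Fintype.card_prod, ZMod.card,
      Nat.cast_sub (by nlinarith)]
    push_cast
    ring
  have hc' : ((univ.erase (0 : ZMod n × ZMod n)).card : ℂ) = (n : ℂ) ^ 2 - 1 := by
    exact_mod_cast congrArg (Complex.ofReal) hc
  have hne : (n : ℂ) ^ 2 - 1 ≠ 0 := by exact_mod_cast hpos.ne'
  have h1 : f p - (∑ z, f z) / ((n : ℂ) ^ 2 - 1)
      = (∑ z ∈ univ.erase (0 : ZMod n × ZMod n), (f p - f z)) / ((n : ℂ) ^ 2 - 1) := by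
    rw [← add_sum_erase univ _ (mem_univ (0 : ZMod n × ZMod n)), hf, zero_add, sum_sub_distrib,
      sum_const, nsmul_eq_mul, hc', sub_div, mul_div_cancel_left₀ _ hne]
  have h2 : ‖(n : ℂ) ^ 2 - 1‖ = n ^ 2 - 1 := by
    rw [← hc', ← hc]; simp
  rw [h1, norm_div, h2, div_le_iff₀ hpos]
  refine (norm_sum_le _ _).trans ?_
  refine (sum_le_card_nsmul _ _ _ fun z hz =>
    norm_sub_le_energy hn χ f hp (ne_of_mem_erase hz)).trans ?_
  rw [nsmul_eq_mul, hc, mul_comm]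

lemma sub_stepOp_sum_pairTransform (hn : 3 ≤ n) (χ : AddChar (ZMod n × ZMod n) ℂ) (N : ℕ)
    (z : ZMod n × ZMod n) :
    (∑ j ∈ range N, pairTransform χ j z) - stepOp χ (fun z => ∑ j ∈ range N, pairTransform χ j z) z
      = pairTransform χ 0 z - pairTransform χ N z := by
  have : stepOp χ (fun z => ∑ j ∈ range N, pairTransform χ j z) z
      = ∑ j ∈ range N, pairTransform χ (j + 1) z := by
    simp only [pairTransform_succ hn, stepOp, mul_sum]
    rw [sum_comm]
  rw [this, ← sum_sub_distrib]
  exact sum_range_sub' (fun j => pairTransform χ j z) N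

set_option maxHeartbeats 400000 in
/-- The energy of the occupation measure up to time `N`. -/
lemma energy_sum_pairTransform_le (hn : 3 ≤ n) (χ : AddChar (ZMod n × ZMod n) ℂ) (N : ℕ) :
    energy χ (fun z => ∑ j ∈ range N, pairTransform χ j z)
      ≤ 40 * N / (n ^ 2 - 1) + 6400 * n := by
  have hn3 : (3 : ℝ) ≤ n := by exact_mod_cast hn
  have hpos : (0 : ℝ) < n ^ 2 - 1 := by nlinarith
  set H : ZMod n × ZMod n → ℂ := fun z => ∑ j ∈ range N, pairTransform χ j z with hH
  have hH0 : H 0 = 0 := sum_eq_zero fun j _ => pairTransform_zero_right hn χ j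
  have hstep : ∀ z, H z - stepOp χ H z = pairTransform χ 0 z - pairTransform χ N z :=
    sub_stepOp_sum_pairTransform hn χ N
  set E := energy χ H with hE
  have hE0 : 0 ≤ E := energy_nonneg χ H
  have hsum : ‖∑ z, H z‖ ≤ N := by
    rw [hH, sum_comm]
    refine (norm_sum_le _ _).trans ((sum_le_card_nsmul _ _ 1 fun j _ => ?_).trans ?_)
    · exact (norm_sum_le _ _).trans (sum_norm_pairTransform_le hn χ j)
    · simp
  have h2 : ‖(n : ℂ) ^ 2 - 1‖ = n ^ 2 - 1 := by
    rw [show (n : ℂ) ^ 2 - 1 = ((n ^ 2 - 1 : ℝ) : ℂ) by push_cast; rfl, Complex.norm_real,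
      Real.norm_of_nonneg hpos.le]
  have hsup : ∀ z, ‖H z‖ ≤ N / (n ^ 2 - 1) + 4 * √(n * E) := by
    intro z
    by_cases hz : z = 0
    · rw [hz, hH0, norm_zero]; positivity
    have h1 := norm_sub_average_le hn χ H hH0 hz
    have h3 : ‖(∑ z, H z) / ((n : ℂ) ^ 2 - 1)‖ ≤ N / (n ^ 2 - 1) := by
      rw [norm_div, h2]; gcongr
    have h4 := norm_sub_norm_le (H z) ((∑ z, H z) / ((n : ℂ) ^ 2 - 1))
    linarith
  have hmain : E ≤ 20 * (N / (n ^ 2 - 1) + 4 * √(n * E)) := by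
    have hE' := energy_eq hn χ H
    simp only [hstep, ← hE] at hE'
    have h5 : (∑ z, (starRingEnd ℂ) (H z) * (pairTransform χ 0 z - pairTransform χ N z)).re
        ≤ 2 * (N / (n ^ 2 - 1) + 4 * √(n * E)) := by
      refine (Complex.re_le_norm _).trans ((norm_sum_le _ _).trans ?_)
      calc ∑ z, ‖(starRingEnd ℂ) (H z) * (pairTransform χ 0 z - pairTransform χ N z)‖
          ≤ ∑ z, (N / (n ^ 2 - 1) + 4 * √(n * E))
              * (‖pairTransform χ 0 z‖ + ‖pairTransform χ N z‖) := by
            refine sum_le_sum fun z _ => ?_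
            rw [norm_mul, RCLike.norm_conj]
            exact mul_le_mul (hsup z) (norm_sub_le _ _) (norm_nonneg _) (by positivity)
        _ ≤ (N / (n ^ 2 - 1) + 4 * √(n * E)) * 2 := by
            rw [← mul_sum, sum_add_distrib]
            refine mul_le_mul_of_nonneg_left ?_ (by positivity)
            linarith [sum_norm_pairTransform_le hn χ 0, sum_norm_pairTransform_le hn χ N]
        _ = _ := by ring
    linarith
  have h6 : 80 * √(n * E) ≤ E / 2 + 3200 * n := by
    rw [Real.sqrt_mul (by positivity)]
    have a1 := Real.sq_sqrt hE0
    have a2 := Real.sq_sqrt (show (0 : ℝ) ≤ n by positivity)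
    nlinarith [sq_nonneg (√E - 80 * √(n : ℝ))]
  have : 40 * (N : ℝ) / (n ^ 2 - 1) = 40 * (N / (n ^ 2 - 1)) := by ring
  rw [this]
  linarith

end SinglePiece

namespace SinglePiece

variable {n : ℕ} [NeZero n]

/-- The eigenvalue of the (negative) Laplacian of the discrete torus at frequency `k`. -/
noncomputable def lapEigenvalue (k : ZMod n × ZMod n) : ℝ :=
  4 - 2 * (ZMod.stdAddChar k.1).re - 2 * (ZMod.stdAddChar k.2).re

/-- The potential of a unit current flowing from `(1, 0)` to `(-1, 0)` in the discrete torus. -/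
noncomputable def potential (z : ZMod n × ZMod n) : ℝ :=
  (1 / n ^ 2) * ∑ k : ZMod n × ZMod n, 2 * (ZMod.stdAddChar (k.1 * z.1 + k.2 * z.2)).im *
    (ZMod.stdAddChar k.1).im / lapEigenvalue k

/-- Half of the effective resistance between `(1, 0)` and `(-1, 0)` in the discrete torus. -/
noncomputable def halfResistance (n : ℕ) [NeZero n] : ℝ :=
  (1 / n ^ 2) * ∑ k : ZMod n × ZMod n, 2 * (ZMod.stdAddChar k.1).im ^ 2 / lapEigenvalue k

lemma re_sq_add_im_sq_stdAddChar (a : ZMod n) :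
    (ZMod.stdAddChar a).re ^ 2 + (ZMod.stdAddChar a).im ^ 2 = 1 := by
  have h := AddChar.norm_apply (ZMod.stdAddChar (N := n)) a
  have h2 : ‖ZMod.stdAddChar a‖ ^ 2 = 1 := by rw [h]; norm_num
  rw [Complex.sq_norm, Complex.normSq_apply] at h2
  linarith

lemma re_stdAddChar_le_one (a : ZMod n) : (ZMod.stdAddChar a).re ≤ 1 := by
  have := re_sq_add_im_sq_stdAddChar a
  nlinarith [sq_nonneg (ZMod.stdAddChar a).im]

lemma neg_one_le_re_stdAddChar (a : ZMod n) : -1 ≤ (ZMod.stdAddChar a).re := by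
  have := re_sq_add_im_sq_stdAddChar a
  nlinarith [sq_nonneg (ZMod.stdAddChar a).im]

lemma stdAddChar_neg (a : ZMod n) :
    ZMod.stdAddChar (-a) = (starRingEnd ℂ) (ZMod.stdAddChar a) := by
  rw [AddChar.map_neg_eq_conj]

lemma lapEigenvalue_nonneg (k : ZMod n × ZMod n) : 0 ≤ lapEigenvalue k := by
  unfold lapEigenvalue
  linarith [re_stdAddChar_le_one k.1, re_stdAddChar_le_one k.2]

lemma im_eq_zero_of_lapEigenvalue {k : ZMod n × ZMod n} (h : lapEigenvalue k = 0) :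
    (ZMod.stdAddChar k.1).im = 0 := by
  unfold lapEigenvalue at h
  have h1 : (ZMod.stdAddChar k.1).re = 1 := by
    linarith [re_stdAddChar_le_one k.1, re_stdAddChar_le_one k.2]
  have := re_sq_add_im_sq_stdAddChar k.1
  rw [h1] at this
  exact pow_eq_zero_iff (two_ne_zero) |>.1 (by linarith)

lemma potential_neg (z : ZMod n × ZMod n) : potential (-z) = -potential z := by
  unfold potential
  rw [← mul_neg, ← sum_neg_distrib]
  congr 1
  refine sum_congr rfl fun k _ => ?_
  have : k.1 * (-z).1 + k.2 * (-z).2 = -(k.1 * z.1 + k.2 * z.2) := by simp; ring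
  rw [this, stdAddChar_neg, Complex.conj_im]
  ring

lemma potential_zero : potential (0 : ZMod n × ZMod n) = 0 := by
  have := potential_neg (0 : ZMod n × ZMod n)
  rw [neg_zero] at this
  linarith

lemma potential_one_zero : potential ((1, 0) : ZMod n × ZMod n) = halfResistance n := by
  unfold potential halfResistance
  congr 1
  refine sum_congr rfl fun k _ => ?_
  simp only [mul_one, mul_zero, add_zero]
  ring

lemma potential_zero_one : potential ((0, 1) : ZMod n × ZMod n) = 0 := by
  have h : potential ((0, 1) : ZMod n × ZMod n) = -potential ((0, 1) : ZMod n × ZMod n) := by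
    conv_lhs => unfold potential
    conv_rhs => unfold potential
    rw [← mul_neg, ← sum_neg_distrib]
    congr 1
    rw [← Equiv.sum_comp ((Equiv.neg (ZMod n)).prodCongr (Equiv.refl (ZMod n)))]
    refine sum_congr rfl fun k _ => ?_
    simp [lapEigenvalue, stdAddChar_neg]
    ring
  linarith

lemma halfResistance_nonneg : 0 ≤ halfResistance n := by
  unfold halfResistance
  refine mul_nonneg (by positivity) (sum_nonneg fun k _ => ?_)
  exact div_nonneg (by positivity) (lapEigenvalue_nonneg k)

lemma halfResistance_le : halfResistance n ≤ 2 := by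
  have hn0 : (0 : ℝ) < n := by exact_mod_cast Nat.pos_of_ne_zero (NeZero.ne n)
  have h : ∀ k : ZMod n × ZMod n, 2 * (ZMod.stdAddChar k.1).im ^ 2 / lapEigenvalue k ≤ 2 := by
    intro k
    refine div_le_of_le_mul₀ (lapEigenvalue_nonneg k) (by norm_num) ?_
    unfold lapEigenvalue
    nlinarith [re_stdAddChar_le_one k.1, re_stdAddChar_le_one k.2, neg_one_le_re_stdAddChar k.1,
      re_sq_add_im_sq_stdAddChar k.1]
  unfold halfResistance
  have := sum_le_card_nsmul univ _ 2 fun k (_ : k ∈ (univ : Finset (ZMod n × ZMod n))) => h k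
  rw [card_univ, Fintype.card_prod, ZMod.card, nsmul_eq_mul] at this
  push_cast at this
  rw [one_div, inv_mul_le_iff₀ (by positivity)]
  linarith

lemma sum_stdAddChar_mul (z : ZMod n × ZMod n) :
    ∑ k : ZMod n × ZMod n, ZMod.stdAddChar (k.1 * z.1 + k.2 * z.2)
      = if z = 0 then (n : ℂ) ^ 2 else 0 := by
  have h := fun b : ZMod n => AddChar.sum_mulShift b (ZMod.isPrimitive_stdAddChar n)
  rw [Fintype.sum_prod_type]
  simp only [AddChar.map_add_eq_mul, ← mul_sum, ← sum_mul, h, ZMod.card]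
  by_cases h1 : z.1 = 0 <;> by_cases h2 : z.2 = 0 <;> simp [h1, h2, Prod.ext_iff, sq]

lemma laplacian_potential (z : ZMod n × ZMod n) :
    4 * potential z - potential (z + (1, 0)) - potential (z + (-1, 0)) - potential (z + (0, 1))
        - potential (z + (0, -1))
      = (if z = (1, 0) then 1 else 0) - (if z = (-1, 0) then 1 else 0) := by
  have hn0 : (n : ℝ) ≠ 0 := by exact_mod_cast NeZero.ne n
  have key : ∀ k : ZMod n × ZMod n,
      4 * (2 * (ZMod.stdAddChar (k.1 * z.1 + k.2 * z.2)).im * (ZMod.stdAddChar k.1).im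
          / lapEigenvalue k)
        - 2 * (ZMod.stdAddChar (k.1 * (z.1 + 1) + k.2 * (z.2 + 0))).im *
          (ZMod.stdAddChar k.1).im / lapEigenvalue k
        - 2 * (ZMod.stdAddChar (k.1 * (z.1 + -1) + k.2 * (z.2 + 0))).im *
          (ZMod.stdAddChar k.1).im / lapEigenvalue k
        - 2 * (ZMod.stdAddChar (k.1 * (z.1 + 0) + k.2 * (z.2 + 1))).im *
          (ZMod.stdAddChar k.1).im / lapEigenvalue k
        - 2 * (ZMod.stdAddChar (k.1 * (z.1 + 0) + k.2 * (z.2 + -1))).im *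
          (ZMod.stdAddChar k.1).im / lapEigenvalue k
      = (ZMod.stdAddChar (k.1 * (z - (1, 0)).1 + k.2 * (z - (1, 0)).2)).re
        - (ZMod.stdAddChar (k.1 * (z - (-1, 0)).1 + k.2 * (z - (-1, 0)).2)).re := by
    intro k
    have a1 : k.1 * (z.1 + 1) + k.2 * (z.2 + 0) = (k.1 * z.1 + k.2 * z.2) + k.1 := by ring
    have a2 : k.1 * (z.1 + -1) + k.2 * (z.2 + 0) = (k.1 * z.1 + k.2 * z.2) + -k.1 := by ring
    have a3 : k.1 * (z.1 + 0) + k.2 * (z.2 + 1) = (k.1 * z.1 + k.2 * z.2) + k.2 := by ring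
    have a4 : k.1 * (z.1 + 0) + k.2 * (z.2 + -1) = (k.1 * z.1 + k.2 * z.2) + -k.2 := by ring
    have a5 : k.1 * (z - (1, 0)).1 + k.2 * (z - (1, 0)).2
        = (k.1 * z.1 + k.2 * z.2) + -k.1 := by simp; ring
    have a6 : k.1 * (z - (-1, 0)).1 + k.2 * (z - (-1, 0)).2
        = (k.1 * z.1 + k.2 * z.2) + k.1 := by simp; ring
    rw [a1, a2, a3, a4, a5, a6]
    simp only [AddChar.map_add_eq_mul, stdAddChar_neg, Complex.mul_im, Complex.mul_re,
      Complex.conj_re, Complex.conj_im]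
    set u := ZMod.stdAddChar (k.1 * z.1) with hu
    set v := ZMod.stdAddChar (k.2 * z.2) with hv
    by_cases hL : lapEigenvalue k = 0
    · simp [hL, im_eq_zero_of_lapEigenvalue hL]
    · have hL' : lapEigenvalue k
          = 4 - 2 * (ZMod.stdAddChar k.1).re - 2 * (ZMod.stdAddChar k.2).re := rfl
      field_simp
      rw [hL']
      ring
  have e : ∀ a : ZMod n × ZMod n, (∑ k : ZMod n × ZMod n,
      (ZMod.stdAddChar (k.1 * (z - a).1 + k.2 * (z - a).2)).re)
        = if z = a then (n : ℝ) ^ 2 else 0 := by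
    intro a
    rw [← Complex.re_sum, sum_stdAddChar_mul]
    simp only [sub_eq_zero]
    split_ifs
    · rw [← Complex.ofReal_natCast, ← Complex.ofReal_pow, Complex.ofReal_re]
    · simp
  have h := sum_congr (rfl : (univ : Finset (ZMod n × ZMod n)) = univ) fun k _ => key k
  simp only [sum_sub_distrib, e, ← mul_sum univ _ (4 : ℝ)] at h
  have h' := congrArg (fun x : ℝ => (1 / (n : ℝ) ^ 2) * x) h
  have h1 : (1 / (n : ℝ) ^ 2) * ((if z = (1, 0) then (n : ℝ) ^ 2 else 0)
      - if z = (-1, 0) then (n : ℝ) ^ 2 else 0)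
      = (if z = (1, 0) then 1 else 0) - (if z = (-1, 0) then 1 else 0) := by
    split_ifs <;> field_simp <;> ring
  rw [← h1]
  unfold potential
  refine Eq.trans ?_ h'
  simp only [Prod.fst_add, Prod.snd_add]
  ring

omit [NeZero n] in
lemma sub_stepOp_apply (hn : 3 ≤ n) (χ : AddChar (ZMod n × ZMod n) ℂ)
    (f : ZMod n × ZMod n → ℂ) {z : ZMod n × ZMod n} (hz : z ≠ 0) :
    f z - stepOp χ f z = (1 / 5) *
      ((4 * f z - f (z + (1, 0)) - f (z + (-1, 0)) - f (z + (0, 1)) - f (z + (0, -1)))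
        + ((if z = (-1, 0) then f 0 - χ (1, 0) * f (1, 0) else 0)
        + (if z = (1, 0) then f 0 - χ (-1, 0) * f (-1, 0) else 0)
        + (if z = (0, -1) then f 0 - χ (0, 1) * f (0, 1) else 0)
        + (if z = (0, 1) then f 0 - χ (0, -1) * f (0, -1) else 0))) := by
  have key : ∀ d : ZMod n × ZMod n, twist χ d z * f (hop d z)
      = f (z + d) - (if z = -d then f 0 - χ d * f d else 0) := by
    intro d
    by_cases h : z = -d
    · subst h; rw [hop_neg_self, twist, if_pos rfl, if_pos rfl]; simp
    · rw [hop_of_ne hz h, twist, if_neg h, if_neg h]; simp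
  unfold stepOp
  rw [sum_displacements hn]
  simp only [key, neg_zero, if_neg hz, Prod.neg_mk, neg_neg, add_zero]
  ring

lemma energy_potential (hn : 3 ≤ n) :
    energy 1 (fun z : ZMod n × ZMod n => (potential z : ℂ)) ≤ 24 := by
  have h1 := zmod_one_ne_zero hn
  have h2 := zmod_neg_one_ne_one hn
  have hr0 := halfResistance_nonneg (n := n)
  have hr2 := halfResistance_le (n := n)
  have hm1 : potential ((-1, 0) : ZMod n × ZMod n) = -halfResistance n := by
    rw [← potential_one_zero, ← potential_neg]; simp
  have hm2 : potential ((0, -1) : ZMod n × ZMod n) = 0 := by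
    have h := potential_neg ((0, 1) : ZMod n × ZMod n)
    rwa [potential_zero_one, Prod.neg_mk, neg_zero, neg_zero] at h
  set r := halfResistance n with hr
  have hz : ∀ z : ZMod n × ZMod n, (starRingEnd ℂ) (potential z : ℂ)
      * ((potential z : ℂ) - stepOp 1 (fun z => (potential z : ℂ)) z)
      = (if z = (1, 0) then ((1 / 5 * (r * (1 + r)) : ℝ) : ℂ) else 0)
        + (if z = (-1, 0) then ((1 / 5 * (r * (1 + r)) : ℝ) : ℂ) else 0) := by
    intro z
    by_cases h0 : z = 0
    · subst h0; simp [potential_zero, Prod.ext_iff, h1.symm, h1]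
    have hs := sub_stepOp_apply hn 1 (fun z : ZMod n × ZMod n => (potential z : ℂ)) h0
    rw [hs]
    have hl := congrArg (Complex.ofReal) (laplacian_potential z)
    push_cast at hl
    rw [hl, Complex.conj_ofReal]
    simp only [AddChar.one_apply, one_mul, hm1, hm2, potential_zero, potential_zero_one,
      potential_one_zero, ← hr]
    by_cases c1 : z = (1, 0)
    · subst c1
      simp [potential_one_zero, h1, h2.symm, ← hr]
      ring
    by_cases c2 : z = (-1, 0)
    · subst c2
      simp [hm1, h1, h2]
      ring
    simp [c1, c2]
  rw [energy_eq hn]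
  simp only [hz]
  rw [sum_add_distrib, sum_ite_eq', sum_ite_eq']
  simp only [mem_univ, if_true]
  rw [← Complex.ofReal_add, Complex.ofReal_re]
  nlinarith

lemma abs_potential_le (hn : 3 ≤ n) (z : ZMod n × ZMod n) : |potential z| ≤ 10 * √n := by
  by_cases hz : z = 0
  · rw [hz, potential_zero, abs_zero]; positivity
  have h := norm_sub_le_energy hn 1 (fun z : ZMod n × ZMod n => (potential z : ℂ)) hz
    (neg_ne_zero.2 hz)
  rw [potential_neg, ← Complex.ofReal_sub, Complex.norm_real, sub_neg_eq_add, ← two_mul,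
    Real.norm_eq_abs, abs_mul, abs_two] at h
  have h2 : √(n * energy 1 (fun z : ZMod n × ZMod n => (potential z : ℂ))) ≤ 5 * √n := by
    rw [show (5 : ℝ) = √(5 ^ 2) by simp, ← Real.sqrt_mul (by norm_num)]
    apply Real.sqrt_le_sqrt
    have := energy_potential hn
    nlinarith [(show (0 : ℝ) ≤ n by positivity)]
  linarith

/-- The first order approximation of the top eigenfunction of the twisted transfer operator,
for a character whose values at the basis vectors have arguments `a` and `b`. -/
noncomputable def corrector (a b : ℝ) (z : ZMod n × ZMod n) : ℂ :=
  1 + Complex.I * ((a * potential z + b * potential z.swap : ℝ) : ℂ)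

/-- The residual of the corrector. -/
noncomputable def residual (r θ : ℝ) : ℂ :=
  1 - Complex.exp (-(θ * Complex.I))
    - Complex.I * (θ / (1 + r)) * (1 + r * Complex.exp (-(θ * Complex.I)))

lemma norm_residual_le {r : ℝ} (hr : 0 ≤ r) {θ : ℝ} (hθ : |θ| ≤ 1) :
    ‖residual r θ‖ ≤ 3 * θ ^ 2 := by
  have hr1 : (1 + r : ℂ) ≠ 0 := by
    have : (1 + r : ℝ) ≠ 0 := by positivity
    exact_mod_cast this
  have e : residual r θ = -(Complex.exp (-(θ * Complex.I)) - 1 - (-(θ * Complex.I)))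
      - Complex.I * ((r * θ / (1 + r) : ℝ) : ℂ) * (Complex.exp (-(θ * Complex.I)) - 1) := by
    unfold residual
    push_cast
    field_simp
    ring
  have n1 : ‖(-(θ * Complex.I) : ℂ)‖ = |θ| := by simp
  have b1 : ‖Complex.exp (-(θ * Complex.I)) - 1 - (-(θ * Complex.I))‖ ≤ |θ| ^ 2 := by
    rw [← n1]; exact Complex.norm_exp_sub_one_sub_id_le (by rw [n1]; exact hθ)
  have b2 : ‖Complex.exp (-(θ * Complex.I)) - 1‖ ≤ 2 * |θ| := by
    rw [← n1]; exact Complex.norm_exp_sub_one_le (by rw [n1]; exact hθ)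
  have b3 : |r * θ / (1 + r)| ≤ |θ| := by
    rw [abs_div, abs_mul, abs_of_nonneg hr, abs_of_nonneg (by linarith : 0 ≤ 1 + r),
      div_le_iff₀ (by linarith)]
    nlinarith [abs_nonneg θ]
  rw [e]
  refine (norm_sub_le _ _).trans ?_
  rw [norm_neg, norm_mul, norm_mul, Complex.norm_I, one_mul, Complex.norm_real, Real.norm_eq_abs]
  have := mul_le_mul b3 b2 (norm_nonneg _) (abs_nonneg θ)
  rw [← sq_abs θ]
  nlinarith

lemma residual_neg (r θ : ℝ) : residual r (-θ) = (starRingEnd ℂ) (residual r θ) := by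
  unfold residual
  simp only [map_sub, map_mul, map_add, map_one, map_div₀, Complex.conj_ofReal, Complex.conj_I,
    ← Complex.exp_conj, map_neg]
  push_cast
  ring_nf

lemma re_residual (r θ : ℝ) :
    (residual r θ).re = 1 - Real.cos θ - r / (1 + r) * θ * Real.sin θ := by
  have e : Complex.exp (-(θ * Complex.I)) = ((Real.cos θ : ℝ) : ℂ) - (Real.sin θ : ℝ) * Complex.I := by
    rw [← neg_mul, Complex.exp_mul_I, Complex.cos_neg, Complex.sin_neg]; push_cast; ring
  have e2 : residual r θ = ((1 - Real.cos θ - r / (1 + r) * θ * Real.sin θ : ℝ) : ℂ)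
      + ((Real.sin θ - θ / (1 + r) * (1 + r * Real.cos θ) : ℝ) : ℂ) * Complex.I := by
    unfold residual
    rw [e]
    push_cast
    linear_combination ((r : ℂ) / (1 + r) * θ * Complex.sin θ) * Complex.I_sq
  rw [e2, Complex.add_re, Complex.ofReal_re, Complex.re_ofReal_mul, Complex.I_re, mul_zero, add_zero]


end SinglePiece

namespace SinglePiece

variable {n : ℕ} [NeZero n]

lemma corrector_sub_stepOp (hn : 3 ≤ n) (χ : AddChar (ZMod n × ZMod n) ℂ) {a b : ℝ}
    (ha : χ (1, 0) = Complex.exp (a * Complex.I)) (hb : χ (0, 1) = Complex.exp (b * Complex.I))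
    {z : ZMod n × ZMod n} (hz : z ≠ 0) :
    corrector (a / (1 + halfResistance n)) (b / (1 + halfResistance n)) z
      - stepOp χ⁻¹ (corrector (a / (1 + halfResistance n)) (b / (1 + halfResistance n))) z
    = (1 / 5) * ((if z = (-1, 0) then residual (halfResistance n) a else 0)
        + (if z = (1, 0) then residual (halfResistance n) (-a) else 0)
        + (if z = (0, -1) then residual (halfResistance n) b else 0)
        + (if z = (0, 1) then residual (halfResistance n) (-b) else 0)) := by
  have h1 := zmod_one_ne_zero hn
  have h2 := zmod_neg_one_ne_one hn
  have p10 := potential_one_zero (n := n)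
  have p01 := potential_zero_one (n := n)
  have pm10 : potential ((-1, 0) : ZMod n × ZMod n) = -halfResistance n := by
    rw [← potential_one_zero, ← potential_neg]; simp
  have pm01 : potential ((0, -1) : ZMod n × ZMod n) = 0 := by
    have h := potential_neg ((0, 1) : ZMod n × ZMod n)
    rwa [potential_zero_one, Prod.neg_mk, neg_zero, neg_zero] at h
  have ha' : χ (-1, 0) = Complex.exp (-(a * Complex.I)) := by
    rw [Complex.exp_neg, ← ha, ← AddChar.map_neg_eq_inv]; simp
  have hb' : χ (0, -1) = Complex.exp (-(b * Complex.I)) := by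
    rw [Complex.exp_neg, ← hb, ← AddChar.map_neg_eq_inv]; simp
  rw [sub_stepOp_apply hn _ _ hz]
  congr 1
  have l1 := congrArg Complex.ofReal (laplacian_potential z)
  have l2 := congrArg Complex.ofReal (laplacian_potential z.swap)
  have hs : ∀ x y : ZMod n, z.swap + (x, y) = (z + (y, x)).swap := fun x y => by ext <;> simp
  simp only [hs] at l2
  push_cast at l1 l2
  have t1 : z.swap = (1, 0) ↔ z = (0, 1) := by
    rw [Prod.ext_iff, Prod.ext_iff]; simp [and_comm]
  have t2 : z.swap = (-1, 0) ↔ z = (0, -1) := by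
    rw [Prod.ext_iff, Prod.ext_iff]; simp [and_comm]
  rw [if_congr t1 rfl rfl, if_congr t2 rfl rfl] at l2
  simp only [corrector, AddChar.inv_apply, Prod.neg_mk, neg_zero, neg_neg, ha, hb, ha', hb',
    Prod.swap_zero, Prod.swap_prod_mk, p10, p01, pm10, pm01, potential_zero, residual]
  set r := halfResistance n
  push_cast
  have hr : (1 + r : ℂ) ≠ 0 := by
    have : (1 + r : ℝ) ≠ 0 := by have := halfResistance_nonneg (n := n); positivity
    exact_mod_cast this
  by_cases c1 : z = (1, 0)
  · subst c1
    simp [h1, h2.symm] at l1 l2 ⊢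
    linear_combination Complex.I * (a / (1 + r)) * l1 + Complex.I * (b / (1 + r)) * l2
  by_cases c2 : z = (-1, 0)
  · subst c2
    simp [h1, h2] at l1 l2 ⊢
    linear_combination Complex.I * (a / (1 + r)) * l1 + Complex.I * (b / (1 + r)) * l2
  by_cases c3 : z = (0, 1)
  · subst c3
    simp [h1, h2.symm] at l1 l2 ⊢
    linear_combination Complex.I * (a / (1 + r)) * l1 + Complex.I * (b / (1 + r)) * l2
  by_cases c4 : z = (0, -1)
  · subst c4
    simp [h1, h2] at l1 l2 ⊢
    linear_combination Complex.I * (a / (1 + r)) * l1 + Complex.I * (b / (1 + r)) * l2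
  simp only [c1, c2, c3, c4, if_false, add_zero] at l1 l2 ⊢
  linear_combination Complex.I * (a / (1 + r)) * l1 + Complex.I * (b / (1 + r)) * l2

lemma norm_corrector_sub_one_le (hn : 3 ≤ n) (a b : ℝ) (z : ZMod n × ZMod n) :
    ‖corrector (a / (1 + halfResistance n)) (b / (1 + halfResistance n)) z - 1‖
      ≤ 10 * √n * (|a| + |b|) := by
  have hr := halfResistance_nonneg (n := n)
  have hq : ∀ x : ℝ, |x / (1 + halfResistance n)| ≤ |x| := fun x => by
    rw [abs_div, abs_of_nonneg (by linarith : 0 ≤ 1 + halfResistance n)]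
    exact div_le_self (abs_nonneg x) (by linarith)
  rw [corrector, add_sub_cancel_left, norm_mul, Complex.norm_I, one_mul, Complex.norm_real,
    Real.norm_eq_abs]
  refine (abs_add_le _ _).trans ?_
  rw [abs_mul, abs_mul]
  have h1 := mul_le_mul (hq a) (abs_potential_le hn z) (abs_nonneg _) (abs_nonneg a)
  have h2 := mul_le_mul (hq b) (abs_potential_le hn z.swap) (abs_nonneg _) (abs_nonneg b)
  linarith

/-- The rate at which the character with phases `a` and `b` decays in expectation. -/
noncomputable def decayRate (n : ℕ) [NeZero n] (a b : ℝ) : ℝ :=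
  2 / 5 * ((residual (halfResistance n) a).re + (residual (halfResistance n) b).re) / (n ^ 2 - 1)

lemma norm_recursion_le (hn : 3 ≤ n) (χ : AddChar (ZMod n × ZMod n) ℂ) {a b : ℝ}
    (ha : χ (1, 0) = Complex.exp (a * Complex.I)) (hb : χ (0, 1) = Complex.exp (b * Complex.I))
    (ha1 : |a| ≤ 1) (hb1 : |b| ≤ 1) (N : ℕ) :
    ‖∑ z, pairTransform χ N z - 1
        + decayRate n a b * ∑ j ∈ range N, ∑ z, pairTransform χ j z‖
      ≤ 20 * √n * (|a| + |b|)
        + 5 * (a ^ 2 + b ^ 2) * √(n * (40 * N / (n ^ 2 - 1) + 6400 * n)) := by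
  have h1 := zmod_one_ne_zero hn
  have h2 := zmod_neg_one_ne_one hn
  have hr0 := halfResistance_nonneg (n := n)
  have hn3 : (3 : ℝ) ≤ n := by exact_mod_cast hn
  have hpos : (0 : ℝ) < n ^ 2 - 1 := by nlinarith
  have hposC : ((n : ℂ) ^ 2 - 1) ≠ 0 := by
    have := hpos.ne'
    exact_mod_cast this
  set r := halfResistance n with hr
  set w := corrector (n := n) (a / (1 + r)) (b / (1 + r)) with hw
  set H : ZMod n × ZMod n → ℂ := fun z => ∑ j ∈ range N, pairTransform χ j z with hH
  have hH0 : H 0 = 0 := sum_eq_zero fun j _ => pairTransform_zero_right hn χ j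
  set S := ∑ z, H z with hS
  have hSX : ∑ j ∈ range N, ∑ z, pairTransform χ j z = S := sum_comm
  set A := S / ((n : ℂ) ^ 2 - 1) with hA
  set B := 4 * √(n * (40 * N / (n ^ 2 - 1) + 6400 * n)) with hB
  have hHp : ∀ p : ZMod n × ZMod n, p ≠ 0 → ‖H p - A‖ ≤ B := fun p hp =>
    (norm_sub_average_le hn χ H hH0 hp).trans (by
      rw [hB]
      gcongr
      exact energy_sum_pairTransform_le hn χ N)
  have id1 : ∑ z, w z * (pairTransform χ 0 z - pairTransform χ N z)
      = (1 / 5) * (residual r a * H (-1, 0) + residual r (-a) * H (1, 0)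
        + residual r b * H (0, -1) + residual r (-b) * H (0, 1)) := by
    have s1 : ∑ z, w z * (pairTransform χ 0 z - pairTransform χ N z)
        = ∑ z, (w z - stepOp χ⁻¹ w z) * H z := by
      simp only [← sub_stepOp_sum_pairTransform hn χ N, sub_mul, mul_sub, sum_sub_distrib]
      rw [sum_mul_stepOp hn]
    have s2 : ∀ z, (w z - stepOp χ⁻¹ w z) * H z
        = (1 / 5) * ((if z = (-1, 0) then residual r a * H (-1, 0) else 0)
        + (if z = (1, 0) then residual r (-a) * H (1, 0) else 0)
        + (if z = (0, -1) then residual r b * H (0, -1) else 0)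
        + (if z = (0, 1) then residual r (-b) * H (0, 1) else 0)) := by
      intro z
      by_cases hz : z = 0
      · subst hz
        simp [hH0, Prod.ext_iff, h1, h1.symm]
      rw [corrector_sub_stepOp hn χ ha hb hz, mul_assoc]
      congr 1
      simp only [add_mul, ite_mul, zero_mul]
      congr 1; congr 1; congr 1
      all_goals
        split_ifs with h
        · rw [h]
        · rfl
    rw [s1]
    simp only [s2, ← mul_sum, sum_add_distrib, sum_ite_eq', mem_univ, if_true]
  have id2 : ∑ z, w z * (pairTransform χ 0 z - pairTransform χ N z)
      = (1 - ∑ z, pairTransform χ N z) + ((w (emptyLabel n) - 1)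
        - ∑ z, (w z - 1) * pairTransform χ N z) := by
    have e0 : ∑ z, w z * pairTransform χ 0 z = w (emptyLabel n) := by
      simp [pairTransform_zero_left]
    simp only [mul_sub, sum_sub_distrib, e0, sub_mul, one_mul]
    ring
  have id3 : residual r a + residual r (-a) + residual r b + residual r (-b)
      = 2 * (((residual r a).re + (residual r b).re : ℝ) : ℂ) := by
    rw [residual_neg, residual_neg, Complex.add_conj, add_assoc, Complex.add_conj]
    push_cast; ring
  have key : ∑ z, pairTransform χ N z - 1 + decayRate n a b * S
      = ((w (emptyLabel n) - 1) - ∑ z, (w z - 1) * pairTransform χ N z)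
        - (1 / 5) * (residual r a * (H (-1, 0) - A) + residual r (-a) * (H (1, 0) - A)
        + residual r b * (H (0, -1) - A) + residual r (-b) * (H (0, 1) - A)) := by
    have hk : (decayRate n a b : ℂ) * S
        = (1 / 5) * (residual r a + residual r (-a) + residual r b + residual r (-b)) * A := by
      rw [id3, hA, decayRate]
      push_cast
      ring
    rw [hk]
    linear_combination id2 - id1
  have hg := norm_corrector_sub_one_le hn a b
  have g1 : ‖∑ z, (w z - 1) * pairTransform χ N z‖ ≤ 10 * √n * (|a| + |b|) := by
    calc _ ≤ ∑ z, 10 * √n * (|a| + |b|) * ‖pairTransform χ N z‖ := by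
          refine (norm_sum_le _ _).trans (sum_le_sum fun z _ => ?_)
          rw [norm_mul]
          exact mul_le_mul_of_nonneg_right (hg z) (norm_nonneg _)
      _ ≤ _ := by
          rw [← mul_sum]
          exact mul_le_of_le_one_right (by positivity) (sum_norm_pairTransform_le hn χ N)
  have hm : ∀ x y : ZMod n, x ≠ 0 ∨ y ≠ 0 → ((x, y) : ZMod n × ZMod n) ≠ 0 := by
    intro x y h h'
    rw [Prod.mk_eq_zero] at h'
    tauto
  have res : ∀ θ : ℝ, |θ| ≤ 1 → ∀ p : ZMod n × ZMod n, p ≠ 0 →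
      ‖residual r θ * (H p - A)‖ ≤ 3 * θ ^ 2 * B := by
    intro θ hθ p hp
    rw [norm_mul]
    exact mul_le_mul (norm_residual_le hr0 hθ) (hHp p hp) (norm_nonneg _) (by positivity)
  have g2 := res a ha1 (-1, 0) (hm _ _ (Or.inl (neg_ne_zero.2 h1)))
  have g3 := res (-a) (by rwa [abs_neg]) (1, 0) (hm _ _ (Or.inl h1))
  have g4 := res b hb1 (0, -1) (hm _ _ (Or.inr (neg_ne_zero.2 h1)))
  have g5 := res (-b) (by rwa [abs_neg]) (0, 1) (hm _ _ (Or.inr h1))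
  rw [hSX, key]
  have f1 := norm_sub_le ((w (emptyLabel n) - 1) - ∑ z, (w z - 1) * pairTransform χ N z)
    ((1 / 5) * (residual r a * (H (-1, 0) - A) + residual r (-a) * (H (1, 0) - A)
        + residual r b * (H (0, -1) - A) + residual r (-b) * (H (0, 1) - A)))
  have f2 := norm_sub_le (w (emptyLabel n) - 1) (∑ z, (w z - 1) * pairTransform χ N z)
  have f3 := norm_add₃_le (a := residual r a * (H (-1, 0) - A))
    (b := residual r (-a) * (H (1, 0) - A)) (c := residual r b * (H (0, -1) - A))
  have f4 := norm_add_le (residual r a * (H (-1, 0) - A) + residual r (-a) * (H (1, 0) - A)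
        + residual r b * (H (0, -1) - A)) (residual r (-b) * (H (0, 1) - A))
  have f5 : ‖(1 / 5 : ℂ) * (residual r a * (H (-1, 0) - A) + residual r (-a) * (H (1, 0) - A)
        + residual r b * (H (0, -1) - A) + residual r (-b) * (H (0, 1) - A))‖
      ≤ (1 / 5) * (6 * (a ^ 2 + b ^ 2) * B) := by
    rw [norm_mul, show ‖(1 / 5 : ℂ)‖ = 1 / 5 by norm_num]
    rw [neg_sq] at g3 g5
    linarith
  have hw0 : ‖w (emptyLabel n) - 1‖ ≤ 10 * √n * (|a| + |b|) := hg (emptyLabel n)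
  have hBn : 0 ≤ (a ^ 2 + b ^ 2) * √(n * (40 * N / (n ^ 2 - 1) + 6400 * n)) := by positivity
  rw [hB] at f5
  linarith

/-- A discrete Gronwall inequality. -/
lemma norm_sub_pow_le {x : ℕ → ℂ} {κ ε : ℝ} {M : ℕ}
    (h : ∀ N ≤ M, ‖x N - 1 + κ * ∑ j ∈ range N, x j‖ ≤ ε) {N : ℕ} (hN : N ≤ M) :
    ‖x N - ((1 - κ) ^ N : ℝ)‖ ≤ ε * (1 + |κ|) ^ N := by
  have hp : ∀ N : ℕ, ((1 - κ : ℂ)) ^ N - 1 + κ * ∑ j ∈ range N, (1 - κ : ℂ) ^ j = 0 := by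
    intro N
    induction N with
    | zero => simp
    | succ N ih => rw [sum_range_succ, pow_succ]; linear_combination ih
  have hg : ∀ N : ℕ, ε + |κ| * ∑ j ∈ range N, ε * (1 + |κ|) ^ j = ε * (1 + |κ|) ^ N := by
    intro N
    induction N with
    | zero => simp
    | succ N ih => rw [sum_range_succ, pow_succ]; linear_combination ih
  induction N using Nat.strong_induction_on with
  | _ N ih =>
    have e : x N - ((1 - κ) ^ N : ℝ) = (x N - 1 + κ * ∑ j ∈ range N, x j)
        - κ * ∑ j ∈ range N, (x j - ((1 - κ) ^ j : ℝ)) := by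
      push_cast
      rw [sum_sub_distrib]
      linear_combination -hp N
    rw [e, ← hg]
    refine (norm_sub_le _ _).trans (add_le_add (h N hN) ?_)
    rw [norm_mul, Complex.norm_real, Real.norm_eq_abs]
    refine mul_le_mul_of_nonneg_left ?_ (abs_nonneg κ)
    refine (norm_sum_le _ _).trans (sum_le_sum fun j hj => ?_)
    have := mem_range.1 hj
    exact ih j this (by omega)

end SinglePiece

namespace SinglePiece

open Filter Topology

lemma sum_zmod_eq_sum_range {M : Type*} [AddCommMonoid M] (n : ℕ) [NeZero n] (φ : ZMod n → M) :
    ∑ a, φ a = ∑ k ∈ range n, φ (k : ZMod n) :=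
  sum_nbij' ZMod.val (fun k : ℕ => (k : ZMod n)) (fun a _ => mem_range.2 (ZMod.val_lt a))
    (fun _ _ => mem_univ _) (fun a _ => ZMod.natCast_zmod_val a)
    (fun _ hk => ZMod.val_natCast_of_lt (mem_range.1 hk)) (fun a _ => by rw [ZMod.natCast_zmod_val])

/-- The point of the discrete torus whose cell contains the given point of the plane. -/
noncomputable def gridPoint (n : ℕ) (x : ℝ × ℝ) : ZMod n × ZMod n :=
  ((⌊n * x.1⌋ : ZMod n), (⌊n * x.2⌋ : ZMod n))

lemma measurable_floor_comp (n : ℕ) (φ : ZMod n → ℝ) :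
    Measurable fun x : ℝ => φ (⌊n * x⌋ : ZMod n) :=
  (measurable_from_top (f := fun j : ℤ => φ (j : ZMod n))).comp
    (Int.measurable_floor.comp (measurable_const_mul (n : ℝ)))

lemma measurable_gridPoint_comp {E : Type*} [MeasurableSpace E] (n : ℕ)
    (Φ : ZMod n × ZMod n → E) :
    Measurable fun x => Φ (gridPoint n x) :=
  (measurable_of_countable (fun j : ℤ × ℤ => Φ ((j.1 : ZMod n), (j.2 : ZMod n)))).comp
    ((Int.measurable_floor.comp (measurable_fst.const_mul (n : ℝ))).prodMk
      (Int.measurable_floor.comp (measurable_snd.const_mul (n : ℝ))))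

lemma setIntegral_floor_comp (n : ℕ) [NeZero n] (φ : ZMod n → ℝ) :
    ∫ x in Set.Icc (0 : ℝ) 1, φ (⌊n * x⌋ : ZMod n) = (1 / n) * ∑ a, φ a := by
  have hn0 : (0 : ℝ) < n := by exact_mod_cast Nat.pos_of_ne_zero (NeZero.ne n)
  obtain ⟨C, hC⟩ := (Set.finite_range φ).isBounded.exists_norm_le
  have hint : ∀ a b : ℝ, IntervalIntegrable (fun x => φ (⌊n * x⌋ : ZMod n)) volume a b := by
    intro a b
    refine (intervalIntegrable_const (c := C)).mono_fun
      (measurable_floor_comp n φ).aestronglyMeasurable (ae_of_all _ fun x => ?_)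
    exact (hC _ ⟨_, rfl⟩).trans (le_abs_self C)
  rw [integral_Icc_eq_integral_Ioc, ← intervalIntegral.integral_of_le zero_le_one]
  have h := intervalIntegral.sum_integral_adjacent_intervals (μ := volume)
    (f := fun x => φ (⌊n * x⌋ : ZMod n)) (a := fun k : ℕ => (k : ℝ) / n) (n := n)
    (fun k _ => hint _ _)
  simp only [Nat.cast_zero, zero_div, div_self hn0.ne'] at h
  rw [← h, sum_zmod_eq_sum_range, mul_sum]
  refine sum_congr rfl fun k _ => ?_
  have hle : (k : ℝ) / n ≤ ((k + 1 : ℕ) : ℝ) / n := by gcongr; simp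
  rw [intervalIntegral.integral_congr_Ioo_of_le (g := fun _ => φ (k : ZMod n)) hle,
    intervalIntegral.integral_const, smul_eq_mul]
  · push_cast; ring
  · intro x hx
    have : ⌊n * x⌋ = (k : ℤ) := by
      rw [Int.floor_eq_iff]
      rw [Set.mem_Ioo, div_lt_iff₀ hn0, lt_div_iff₀ hn0] at hx
      push_cast at hx ⊢
      constructor <;> linarith
    simp only [this, Int.cast_natCast]

lemma integrableOn_gridPoint_comp (n : ℕ) [NeZero n] (Φ : ZMod n × ZMod n → ℝ) :
    IntegrableOn (fun x => Φ (gridPoint n x)) (Set.Icc (0 : ℝ) 1 ×ˢ Set.Icc (0 : ℝ) 1) := by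
  obtain ⟨C, hC⟩ := (Set.finite_range Φ).isBounded.exists_norm_le
  exact Measure.integrableOn_of_bounded (M := C)
    ((isCompact_Icc.prod isCompact_Icc).measure_lt_top.ne)
    (measurable_gridPoint_comp n Φ).aestronglyMeasurable (ae_of_all _ fun x => hC _ ⟨_, rfl⟩)

lemma setIntegral_gridPoint_comp (n : ℕ) [NeZero n] (Φ : ZMod n × ZMod n → ℝ) :
    ∫ x in Set.Icc (0 : ℝ) 1 ×ˢ Set.Icc (0 : ℝ) 1, Φ (gridPoint n x)
      = (1 / n ^ 2) * ∑ y, Φ y := by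
  rw [Measure.volume_eq_prod, setIntegral_prod _ (integrableOn_gridPoint_comp n Φ)]
  have e : ∀ x : ℝ, ∫ y in Set.Icc (0 : ℝ) 1, Φ (gridPoint n (x, y))
      = (1 / n) * ∑ b, Φ ((⌊n * x⌋ : ZMod n), b) :=
    fun x => setIntegral_floor_comp n fun b => Φ ((⌊n * x⌋ : ZMod n), b)
  simp only [e]
  rw [integral_const_mul, setIntegral_floor_comp n fun a => ∑ b, Φ (a, b), Fintype.sum_prod_type,
    ← mul_assoc]
  congr 1
  ring

lemma tendsto_floor_mul_div (x : ℝ) :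
    Tendsto (fun n : ℕ => (⌊n * x⌋ : ℝ) / n) atTop (𝓝 x) := by
  have h1 : Tendsto (fun n : ℕ => x - 1 / (n : ℝ)) atTop (𝓝 x) := by
    simpa using tendsto_const_nhds.sub (tendsto_one_div_atTop_nhds_zero_nat (𝕜 := ℝ))
  refine tendsto_of_tendsto_of_tendsto_of_le_of_le' h1 tendsto_const_nhds ?_ ?_
  all_goals
    filter_upwards [eventually_gt_atTop 0] with n hn
    have hn0 : (0 : ℝ) < n := by exact_mod_cast hn
  · rw [le_div_iff₀ hn0, sub_mul, one_div_mul_cancel hn0.ne']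
    linarith [Int.sub_one_lt_floor (n * x)]
  · rw [div_le_iff₀ hn0]
    linarith [Int.floor_le (n * x)]

lemma integral_inv_sub_two_mul_cos {q : ℝ} (hq0 : 0 < q) (hq1 : q < 1) :
    ∫ y in (0 : ℝ)..1, 1 / (q + q⁻¹ - 2 * Real.cos (2 * Real.pi * y)) = 1 / (q⁻¹ - q) := by
  have hD : ∀ y : ℝ, 0 < 1 - q * Real.cos y := fun y => by
    have := Real.cos_le_one y
    nlinarith
  have hE : ∀ y : ℝ, 0 < 1 - 2 * q * Real.cos y + q ^ 2 := fun y => by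
    have := Real.cos_le_one y
    nlinarith [sq_nonneg (1 - q), mul_pos hq0 hq0]
  have hq2 : 0 < q⁻¹ - q := by
    have : 1 < q⁻¹ := (one_lt_inv₀ hq0).2 hq1
    linarith
  set F : ℝ → ℝ := fun y => (1 / (q⁻¹ - q)) * ((1 / Real.pi) * Real.arctan
    (q * Real.sin (2 * Real.pi * y) / (1 - q * Real.cos (2 * Real.pi * y))) + y) with hF
  have hder : ∀ y, HasDerivAt F (1 / (q + q⁻¹ - 2 * Real.cos (2 * Real.pi * y))) y := by
    intro y
    have l : HasDerivAt (fun y : ℝ => 2 * Real.pi * y) (2 * Real.pi) y := by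
      simpa using (hasDerivAt_id y).const_mul (2 * Real.pi)
    have hs := (l.sin).const_mul q
    have hc := ((l.cos).const_mul q).const_sub 1
    refine (((((hs.fun_div hc (hD _).ne').arctan.const_mul (1 / Real.pi))).fun_add
      (hasDerivAt_id' y)).const_mul (1 / (q⁻¹ - q))).congr_deriv ?_
    have hd := hD (2 * Real.pi * y)
    have he := hE (2 * Real.pi * y)
    have hsc := Real.sin_sq_add_cos_sq (2 * Real.pi * y)
    set c := Real.cos (2 * Real.pi * y)
    set s := Real.sin (2 * Real.pi * y)
    have e1 : q + q⁻¹ - 2 * c = (1 - 2 * q * c + q ^ 2) / q := by field_simp; ring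
    have e2 : 1 + (q * s / (1 - q * c)) ^ 2 = (1 - 2 * q * c + q ^ 2) / (1 - q * c) ^ 2 := by
      rw [eq_div_iff (by positivity), add_mul, div_pow, div_mul_cancel₀ _ (by positivity)]
      linear_combination q ^ 2 * hsc
    have e3 : q⁻¹ - q = (1 - q ^ 2) / q := by field_simp
    have hq3 : 1 - q ^ 2 ≠ 0 := by nlinarith
    rw [e1, e2, e3]
    generalize hG : 1 - 2 * q * c + q ^ 2 = G at he
    field_simp
    linear_combination -2 * q ^ 2 * hsc - hG
  rw [intervalIntegral.integral_eq_sub_of_hasDerivAt (fun y _ => hder y)]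
  · simp [hF]
  · refine Continuous.intervalIntegrable ?_ _ _
    refine continuous_const.div (by fun_prop) fun y => ?_
    have := hE (2 * Real.pi * y)
    have e : q + q⁻¹ - 2 * Real.cos (2 * Real.pi * y)
        = q⁻¹ * (1 - 2 * q * Real.cos (2 * Real.pi * y) + q ^ 2) := by field_simp; ring
    rw [e]
    positivity

/-- The continuum limit of the summand of the half resistance. -/
noncomputable def resistanceDensity (x : ℝ × ℝ) : ℝ :=
  2 * Real.sin (2 * Real.pi * x.1) ^ 2 /
    (4 - 2 * Real.cos (2 * Real.pi * x.1) - 2 * Real.cos (2 * Real.pi * x.2))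

lemma resistanceDensity_nonneg (x : ℝ × ℝ) : 0 ≤ resistanceDensity x :=
  div_nonneg (by positivity) (by
    linarith [Real.cos_le_one (2 * Real.pi * x.1), Real.cos_le_one (2 * Real.pi * x.2)])

lemma resistanceDensity_le (x : ℝ × ℝ) : resistanceDensity x ≤ 2 := by
  have h1 := Real.cos_le_one (2 * Real.pi * x.1)
  have h2 := Real.cos_le_one (2 * Real.pi * x.2)
  refine div_le_of_le_mul₀ (by linarith) (by norm_num) ?_
  nlinarith [Real.sin_sq_add_cos_sq (2 * Real.pi * x.1), Real.neg_one_le_cos (2 * Real.pi * x.1)]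

lemma measurable_resistanceDensity : Measurable resistanceDensity := by
  unfold resistanceDensity
  fun_prop

lemma stdAddChar_intCast_eq (n : ℕ) [NeZero n] (j : ℤ) :
    ZMod.stdAddChar (j : ZMod n) = Complex.exp ((2 * Real.pi * (j / n) : ℝ) * Complex.I) := by
  rw [ZMod.stdAddChar_coe]
  congr 1
  push_cast
  ring

lemma halfResistance_eq_setIntegral (n : ℕ) [NeZero n] :
    halfResistance n = ∫ x in Set.Icc (0 : ℝ) 1 ×ˢ Set.Icc (0 : ℝ) 1,
      resistanceDensity (⌊n * x.1⌋ / n, ⌊n * x.2⌋ / n) := by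
  rw [halfResistance, ← setIntegral_gridPoint_comp n]
  congr 1
  funext x
  simp only [gridPoint, lapEigenvalue, stdAddChar_intCast_eq, Complex.exp_ofReal_mul_I_re,
    Complex.exp_ofReal_mul_I_im, resistanceDensity]

lemma ae_mem_Ioo_prod : ∀ᵐ x : ℝ × ℝ ∂volume.restrict (Set.Icc (0 : ℝ) 1 ×ˢ Set.Icc (0 : ℝ) 1),
    x ∈ Set.Ioo (0 : ℝ) 1 ×ˢ Set.Ioo (0 : ℝ) 1 := by
  have h : (Set.Ioo (0 : ℝ) 1 ×ˢ Set.Ioo (0 : ℝ) 1 : Set (ℝ × ℝ))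
      =ᵐ[volume] Set.Icc (0 : ℝ) 1 ×ˢ Set.Icc (0 : ℝ) 1 := by
    rw [Measure.volume_eq_prod]
    exact Measure.set_prod_ae_eq Ioo_ae_eq_Icc Ioo_ae_eq_Icc
  rw [← Measure.restrict_congr_set h]
  exact ae_restrict_mem (measurableSet_Ioo.prod measurableSet_Ioo)

lemma cos_two_pi_mul_lt_one {x : ℝ} (hx : x ∈ Set.Ioo (0 : ℝ) 1) :
    Real.cos (2 * Real.pi * x) < 1 := by
  have h : 0 < Real.sin (Real.pi * x) :=
    Real.sin_pos_of_pos_of_lt_pi (mul_pos Real.pi_pos hx.1)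
      (mul_lt_of_lt_one_right Real.pi_pos hx.2)
  rw [mul_assoc, Real.cos_two_mul]
  nlinarith [Real.sin_sq_add_cos_sq (Real.pi * x)]

lemma tendsto_halfResistance {u : ℕ → ℕ} [∀ j, NeZero (u j)] (hu : Tendsto u atTop atTop) :
    Tendsto (fun j => halfResistance (u j)) atTop
      (𝓝 (∫ x in Set.Icc (0 : ℝ) 1 ×ˢ Set.Icc (0 : ℝ) 1, resistanceDensity x)) := by
  simp only [halfResistance_eq_setIntegral]
  refine tendsto_integral_of_dominated_convergence (fun _ => 2) (fun j => ?_)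
    (integrableOn_const (isCompact_Icc.prod isCompact_Icc).measure_lt_top.ne) (fun j => ?_) ?_
  · have := measurable_resistanceDensity
    exact Measurable.aestronglyMeasurable (by fun_prop)
  · refine ae_of_all _ fun x => ?_
    rw [Real.norm_of_nonneg (resistanceDensity_nonneg _)]
    exact resistanceDensity_le _
  · filter_upwards [ae_mem_Ioo_prod] with x hx
    have h1 := cos_two_pi_mul_lt_one hx.1
    have h2 := Real.cos_le_one (2 * Real.pi * x.2)
    have hc : ContinuousAt resistanceDensity x := by
      unfold resistanceDensity
      refine ContinuousAt.div (by fun_prop) (by fun_prop) ?_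
      linarith
    exact hc.tendsto.comp
      ((((tendsto_floor_mul_div x.1).comp hu)).prodMk_nhds ((tendsto_floor_mul_div x.2).comp hu))

lemma integral_resistanceDensity_right {x : ℝ} (hx : x ∈ Set.Ioo (0 : ℝ) 1) :
    ∫ y in Set.Icc (0 : ℝ) 1, resistanceDensity (x, y)
      = 2 * Real.sin (Real.pi * x) * Real.cos (Real.pi * x) ^ 2
        / √(2 - Real.cos (Real.pi * x) ^ 2) := by
  have hs : 0 < Real.sin (Real.pi * x) :=
    Real.sin_pos_of_pos_of_lt_pi (mul_pos Real.pi_pos hx.1)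
      (mul_lt_of_lt_one_right Real.pi_pos hx.2)
  have hsc := Real.sin_sq_add_cos_sq (Real.pi * x)
  have e1 : Real.cos (2 * Real.pi * x) = 1 - 2 * Real.sin (Real.pi * x) ^ 2 := by
    rw [mul_assoc, Real.cos_two_mul]; linarith
  have e2 : Real.sin (2 * Real.pi * x) = 2 * Real.sin (Real.pi * x) * Real.cos (Real.pi * x) := by
    rw [mul_assoc, Real.sin_two_mul]
  have e3 : 2 - Real.cos (Real.pi * x) ^ 2 = 1 + Real.sin (Real.pi * x) ^ 2 := by linarith
  rw [e3]
  set s := Real.sin (Real.pi * x)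
  set c := Real.cos (Real.pi * x)
  set w := √(1 + s ^ 2) with hw
  have hw2 : w ^ 2 = 1 + s ^ 2 := Real.sq_sqrt (by positivity)
  have hw0 : 0 < w := Real.sqrt_pos.2 (by positivity)
  have hws : s < w := by nlinarith
  have hinv : ((w - s) ^ 2)⁻¹ = (w + s) ^ 2 := by
    refine inv_eq_of_mul_eq_one_right ?_
    have : (w - s) * (w + s) = 1 := by linear_combination hw2
    rw [← mul_pow, this, one_pow]
  have hq0 : 0 < (w - s) ^ 2 := by have := sub_pos.2 hws; positivity
  have hq1 : (w - s) ^ 2 < 1 := by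
    have : (w - s) ^ 2 * (w + s) ^ 2 = 1 := by rw [← hinv, mul_inv_cancel₀ hq0.ne']
    nlinarith
  have h := integral_inv_sub_two_mul_cos hq0 hq1
  rw [hinv] at h
  have e4 : ∀ y, resistanceDensity (x, y) = (8 * s ^ 2 * c ^ 2) *
      (1 / ((w - s) ^ 2 + (w + s) ^ 2 - 2 * Real.cos (2 * Real.pi * y))) := by
    intro y
    simp only [resistanceDensity, e1, e2]
    rw [show (w - s) ^ 2 + (w + s) ^ 2 = 4 - 2 * (1 - 2 * s ^ 2) by linear_combination 2 * hw2]
    ring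
  simp only [e4]
  rw [integral_const_mul, integral_Icc_eq_integral_Ioc,
    ← intervalIntegral.integral_of_le zero_le_one, h]
  rw [show (w + s) ^ 2 - (w - s) ^ 2 = 4 * s * w by ring]
  field_simp
  ring

lemma integral_sin_mul_cos_sq_div_sqrt :
    ∫ x in (0 : ℝ)..1, 2 * Real.sin (Real.pi * x) * Real.cos (Real.pi * x) ^ 2
        / √(2 - Real.cos (Real.pi * x) ^ 2) = 1 - 2 / Real.pi := by
  have hpi := Real.pi_pos
  have h2 : ∀ x, 0 < 2 - Real.cos x ^ 2 := fun x => by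
    nlinarith [Real.sin_sq_add_cos_sq x, sq_nonneg (Real.sin x)]
  set F : ℝ → ℝ := fun x => (-2 / Real.pi) * (Real.arcsin (Real.cos (Real.pi * x) / √2)
    - 1 / 2 * (Real.cos (Real.pi * x) * √(2 - Real.cos (Real.pi * x) ^ 2))) with hF
  have hder : ∀ x, HasDerivAt F (2 * Real.sin (Real.pi * x) * Real.cos (Real.pi * x) ^ 2
        / √(2 - Real.cos (Real.pi * x) ^ 2)) x := by
    intro x
    have l : HasDerivAt (fun y : ℝ => Real.pi * y) Real.pi x := by
      simpa using (hasDerivAt_id x).const_mul Real.pi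
    have hc := l.cos
    have hlt : (Real.cos (Real.pi * x) / √2) ^ 2 < 1 := by
      rw [div_pow, Real.sq_sqrt (by norm_num), div_lt_one (by norm_num)]
      linarith [h2 (Real.pi * x)]
    have harc := (Real.hasDerivAt_arcsin (x := Real.cos (Real.pi * x) / √2)
      (by intro h; rw [h] at hlt; norm_num at hlt)
      (by intro h; rw [h] at hlt; norm_num at hlt)).comp x (hc.div_const (√2))
    have hsq := ((hc.fun_pow 2).const_sub 2).sqrt (h2 _).ne'
    refine ((harc.fun_sub ((hc.fun_mul hsq).const_mul (1 / 2))).const_mul (-2 / Real.pi)).congr_deriv ?_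
    have h2x := h2 (Real.pi * x)
    have e : √(1 - (Real.cos (Real.pi * x) / √2) ^ 2) = √(2 - Real.cos (Real.pi * x) ^ 2) / √2 := by
      rw [← Real.sqrt_div h2x.le, div_pow, Real.sq_sqrt (by norm_num)]
      congr 1; ring
    rw [e]
    set c := Real.cos (Real.pi * x)
    set s := Real.sin (Real.pi * x)
    have hw2 : √(2 - c ^ 2) ^ 2 = 2 - c ^ 2 := Real.sq_sqrt h2x.le
    have hw0 : 0 < √(2 - c ^ 2) := Real.sqrt_pos.2 h2x
    set w := √(2 - c ^ 2)
    field_simp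
    linear_combination (-2 * s) * hw2
  rw [intervalIntegral.integral_eq_sub_of_hasDerivAt (fun y _ => hder y)]
  · have h4 : Real.arcsin (1 / √2) = Real.pi / 4 := by
      rw [← Real.sqrt_div_self', ← Real.sin_pi_div_four, Real.arcsin_sin] <;> linarith
    simp only [hF, mul_one, mul_zero, Real.cos_pi, Real.cos_zero, neg_div, Real.arcsin_neg, h4]
    norm_num
    field_simp
    ring
  · refine Continuous.intervalIntegrable ?_ _ _
    exact Continuous.div (by fun_prop) (by fun_prop) fun x => (Real.sqrt_pos.2 (h2 _)).ne'

lemma setIntegral_resistanceDensity :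
    ∫ x in Set.Icc (0 : ℝ) 1 ×ˢ Set.Icc (0 : ℝ) 1, resistanceDensity x = 1 - 2 / Real.pi := by
  rw [Measure.volume_eq_prod, setIntegral_prod]
  · rw [integral_Icc_eq_integral_Ioc, ← intervalIntegral.integral_of_le zero_le_one,
      ← integral_sin_mul_cos_sq_div_sqrt]
    exact intervalIntegral.integral_congr_Ioo_of_le zero_le_one
      fun x hx => integral_resistanceDensity_right hx
  · refine Measure.integrableOn_of_bounded (M := 2)
      (isCompact_Icc.prod isCompact_Icc).measure_lt_top.ne
      measurable_resistanceDensity.aestronglyMeasurable (ae_of_all _ fun x => ?_)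
    rw [Real.norm_of_nonneg (resistanceDensity_nonneg _)]
    exact resistanceDensity_le _

end SinglePiece

namespace SinglePiece

open Filter Topology

/-- The character of the discrete torus with integer frequency `m`. -/
noncomputable def torusChar (n : ℕ) [NeZero n] (m : ℤ × ℤ) : AddChar (ZMod n × ZMod n) ℂ where
  toFun y := ZMod.stdAddChar ((m.1 : ZMod n) * y.1 + (m.2 : ZMod n) * y.2)
  map_zero_eq_one' := by simp
  map_add_eq_mul' x y := by
    rw [← AddChar.map_add_eq_mul]
    congr 1
    simp only [Prod.fst_add, Prod.snd_add]
    ring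

lemma torusChar_apply (n : ℕ) [NeZero n] (m : ℤ × ℤ) (y : ZMod n × ZMod n) :
    torusChar n m y = ZMod.stdAddChar ((m.1 : ZMod n) * y.1 + (m.2 : ZMod n) * y.2) := rfl

lemma torusChar_one_zero (n : ℕ) [NeZero n] (m : ℤ × ℤ) :
    torusChar n m (1, 0) = Complex.exp ((2 * Real.pi * (m.1 / n) : ℝ) * Complex.I) := by
  rw [torusChar_apply, ← stdAddChar_intCast_eq]
  simp

lemma torusChar_zero_one (n : ℕ) [NeZero n] (m : ℤ × ℤ) :
    torusChar n m (0, 1) = Complex.exp ((2 * Real.pi * (m.2 / n) : ℝ) * Complex.I) := by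
  rw [torusChar_apply, ← stdAddChar_intCast_eq]
  simp

lemma tendsto_one_sub_pow {κ : ℕ → ℝ} {N : ℕ → ℕ} {c : ℝ} (hκ : Tendsto κ atTop (𝓝 0))
    (h : Tendsto (fun j => (N j : ℝ) * κ j) atTop (𝓝 c)) :
    Tendsto (fun j => (1 - κ j) ^ N j) atTop (𝓝 (Real.exp (-c))) := by
  have hpos : ∀ᶠ j in atTop, 0 < 1 - κ j := by
    filter_upwards [hκ.eventually_lt_const zero_lt_one] with j hj
    linarith
  have hlog : Tendsto (fun j => (N j : ℝ) * Real.log (1 - κ j)) atTop (𝓝 (-c)) := by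
    have h1 : Tendsto (fun j => -((N j : ℝ) * κ j) / (1 - κ j)) atTop (𝓝 (-c)) := by
      have := h.neg.div (hκ.const_sub 1) (by norm_num)
      rwa [sub_zero, div_one] at this
    refine tendsto_of_tendsto_of_tendsto_of_le_of_le' h1 h.neg ?_ ?_
    all_goals
      filter_upwards [hpos] with j hj
      have hN : (0 : ℝ) ≤ N j := Nat.cast_nonneg _
    · have := mul_le_mul_of_nonneg_left (Real.one_sub_inv_le_log_of_pos hj) hN
      refine le_trans (le_of_eq ?_) this
      field_simp
      ring
    · have := mul_le_mul_of_nonneg_left (Real.log_le_sub_one_of_pos hj) hN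
      linarith
  refine ((Real.continuous_exp.tendsto _).comp hlog).congr' ?_
  filter_upwards [hpos] with j hj
  rw [Function.comp, mul_comm, Real.exp_mul, Real.exp_log hj, Real.rpow_natCast]

lemma sin_eq_mul_sinc (x : ℝ) : Real.sin x = x * Real.sinc x := by
  by_cases h : x = 0
  · simp [h]
  · rw [Real.sinc_of_ne_zero h]; field_simp

variable {u : ℕ → ℕ} [∀ j, NeZero (u j)]

omit [∀ j, NeZero (u j)] in
lemma tendsto_one_div_comp (hu : Tendsto u atTop atTop) :
    Tendsto (fun j => 1 / (u j : ℝ)) atTop (𝓝 0) :=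
  (tendsto_one_div_atTop_nhds_zero_nat (𝕜 := ℝ)).comp hu

lemma tendsto_mul_sin (hu : Tendsto u atTop atTop) (c : ℝ) :
    Tendsto (fun j => (u j : ℝ) * Real.sin (c / u j)) atTop (𝓝 c) := by
  have h1 : Tendsto (fun j => c * (1 / (u j : ℝ))) atTop (𝓝 0) := by
    simpa using (tendsto_one_div_comp hu).const_mul c
  have h2 := ((Real.continuous_sinc.tendsto 0).comp h1).const_mul c
  rw [Real.sinc_zero, mul_one] at h2
  refine h2.congr fun j => ?_
  have : (u j : ℝ) ≠ 0 := by exact_mod_cast NeZero.ne (u j)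
  rw [sin_eq_mul_sinc, Function.comp, mul_one_div]
  field_simp

lemma tendsto_re_residual (hu : Tendsto u atTop atTop) (c : ℝ) :
    Tendsto (fun j => (u j : ℝ) ^ 2 * (residual (halfResistance (u j)) (c / u j)).re) atTop
      (𝓝 (c ^ 2 / (2 * (Real.pi - 1)))) := by
  have hr := tendsto_halfResistance hu
  rw [setIntegral_resistanceDensity] at hr
  have hpi := Real.pi_gt_three
  have hρ := hr.div (hr.const_add 1) (by
    rw [← add_sub_assoc, sub_ne_zero, ne_eq, eq_div_iff (by positivity)]; nlinarith)
  have hs := tendsto_mul_sin hu c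
  have hs2 := ((tendsto_mul_sin hu (c / 2)).pow 2).const_mul 2
  have h := hs2.sub ((hρ.mul_const c).mul hs)
  have e : 2 * (c / 2) ^ 2 - (1 - 2 / Real.pi) / (1 + (1 - 2 / Real.pi)) * c * c
      = c ^ 2 / (2 * (Real.pi - 1)) := by
    have h1 : Real.pi - 1 ≠ 0 := by linarith
    have h2 : 1 + (1 - 2 / Real.pi) = 2 * (Real.pi - 1) / Real.pi := by field_simp; ring
    rw [h2]
    field_simp
    ring
  rw [e] at h
  refine h.congr fun j => ?_
  have : (u j : ℝ) ≠ 0 := by exact_mod_cast NeZero.ne (u j)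
  rw [re_residual]
  have hc : Real.cos (c / u j) = 1 - 2 * Real.sin (c / 2 / u j) ^ 2 := by
    rw [show c / (u j : ℝ) = 2 * (c / 2 / u j) by ring, Real.cos_two_mul]
    linarith [Real.sin_sq_add_cos_sq (c / 2 / (u j : ℝ))]
  rw [hc]
  simp only [Pi.div_apply]
  field_simp
  ring

lemma tendsto_decayRate (hn : ∀ j, 3 ≤ u j) (hu : Tendsto u atTop atTop) (a b : ℝ) :
    Tendsto (fun j => (u j : ℝ) ^ 4 * decayRate (u j) (a / u j) (b / u j)) atTop
      (𝓝 ((a ^ 2 + b ^ 2) / (2 * cPuz))) := by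
  have h1 : Tendsto (fun j => 1 / (1 - (1 / (u j : ℝ)) ^ 2)) atTop (𝓝 1) := by
    have := ((tendsto_one_div_comp hu).pow 2).const_sub 1
    simpa using this.inv₀ (by norm_num)
  have h := ((((tendsto_re_residual hu a).add (tendsto_re_residual hu b))).const_mul (2 / 5)).mul h1
  have e : 2 / 5 * (a ^ 2 / (2 * (Real.pi - 1)) + b ^ 2 / (2 * (Real.pi - 1))) * 1
      = (a ^ 2 + b ^ 2) / (2 * cPuz) := by
    have h1 : Real.pi - 1 ≠ 0 := by linarith [Real.pi_gt_three]
    unfold cPuz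
    field_simp
  rw [e] at h
  refine h.congr fun j => ?_
  have h0 : (u j : ℝ) ≠ 0 := by exact_mod_cast NeZero.ne (u j)
  have hn3 : (3 : ℝ) ≤ u j := by exact_mod_cast hn j
  have h2 : (u j : ℝ) ^ 2 - 1 ≠ 0 := by nlinarith
  have h3 : 1 / (1 - (1 / (u j : ℝ)) ^ 2) = (u j) ^ 2 / ((u j) ^ 2 - 1) := by
    rw [div_pow, one_pow, one_sub_div (by positivity), one_div_div]
  rw [decayRate, h3]
  field_simp

/-- Convergence of the characteristic function of the position of the piece. -/
lemma tendsto_sum_pairTransform (hn : ∀ j, 3 ≤ u j) (hu : Tendsto u atTop atTop) {N : ℕ → ℕ}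
    {τ : ℝ} (hN : Tendsto (fun j => (N j : ℝ) / (u j) ^ 4) atTop (𝓝 τ)) (m : ℤ × ℤ) :
    Tendsto (fun j => ∑ z, pairTransform (torusChar (u j) m) (N j) z) atTop
      (𝓝 (Real.exp (-(2 * Real.pi ^ 2 * (m.1 ^ 2 + m.2 ^ 2) / cPuz * τ)) : ℝ)) := by
  set a : ℝ := 2 * Real.pi * m.1 with ha
  set b : ℝ := 2 * Real.pi * m.2 with hb
  have hx := tendsto_one_div_comp hu
  have hu0 : ∀ j, (0 : ℝ) < u j := fun j => by
    exact_mod_cast Nat.pos_of_ne_zero (NeZero.ne (u j))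
  set κ : ℕ → ℝ := fun j => decayRate (u j) (a / u j) (b / u j) with hκ
  have hNκ : Tendsto (fun j => (N j : ℝ) * κ j) atTop
      (𝓝 (2 * Real.pi ^ 2 * (m.1 ^ 2 + m.2 ^ 2) / cPuz * τ)) := by
    have h := hN.mul (tendsto_decayRate hn hu a b)
    have e : τ * ((a ^ 2 + b ^ 2) / (2 * cPuz))
        = 2 * Real.pi ^ 2 * (m.1 ^ 2 + m.2 ^ 2) / cPuz * τ := by
      rw [ha, hb]; field_simp
    rw [e] at h
    refine h.congr fun j => ?_
    have := (hu0 j).ne'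
    simp only [hκ]
    field_simp
  have hκ0 : Tendsto κ atTop (𝓝 0) := by
    have h := (tendsto_decayRate hn hu a b).mul (hx.pow 4)
    rw [zero_pow (by norm_num), mul_zero] at h
    refine h.congr fun j => ?_
    have := (hu0 j).ne'
    simp only [hκ]
    field_simp
  have hpow := tendsto_one_sub_pow hκ0 hNκ
  set ε : ℕ → ℝ := fun j => 20 * (√(1 / u j) * (|a| + |b|)) + 5 * ((a ^ 2 + b ^ 2) *
    √(80 * (N j / (u j) ^ 4) * (1 / u j) + 6400 * (1 / u j) ^ 2)) with hε
  have hε0 : Tendsto ε atTop (𝓝 0) := by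
    have h1 : Tendsto (fun j => √(1 / (u j : ℝ))) atTop (𝓝 0) := by
      have := (Real.continuous_sqrt.tendsto 0).comp hx
      rwa [Real.sqrt_zero] at this
    have h2 := (Real.continuous_sqrt.tendsto _).comp
      (((hN.const_mul 80).mul hx).add ((hx.pow 2).const_mul 6400))
    have h3 := ((h1.mul_const (|a| + |b|)).const_mul 20).add
      ((h2.const_mul (a ^ 2 + b ^ 2)).const_mul 5)
    rwa [zero_mul, mul_zero, mul_zero, zero_pow two_ne_zero, mul_zero, add_zero, Real.sqrt_zero,
      mul_zero, mul_zero, add_zero] at h3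
  have hexp : Tendsto (fun j => ε j * Real.exp |N j * κ j|) atTop (𝓝 0) := by
    have := hε0.mul ((Real.continuous_exp.tendsto _).comp hNκ.abs)
    simpa using this
  have hsmall : ∀ c : ℝ, ∀ᶠ j in atTop, |c / u j| ≤ 1 := by
    intro c
    have h : Tendsto (fun j => |c * (1 / (u j : ℝ))|) atTop (𝓝 0) := by
      simpa using (hx.const_mul c).abs
    filter_upwards [h.eventually_le_const zero_lt_one] with j hj
    rwa [mul_one_div] at hj
  have hdiff : Tendsto (fun j => ∑ z, pairTransform (torusChar (u j) m) (N j) z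
      - (((1 - κ j) ^ N j : ℝ) : ℂ)) atTop (𝓝 0) := by
    refine squeeze_zero_norm' ?_ hexp
    filter_upwards [hsmall a, hsmall b] with j haj hbj
    have hn3 : (3 : ℝ) ≤ u j := by exact_mod_cast hn j
    have hrec : ∀ M ≤ N j, ‖∑ z, pairTransform (torusChar (u j) m) M z - 1
        + κ j * ∑ i ∈ range M, ∑ z, pairTransform (torusChar (u j) m) i z‖ ≤ ε j := by
      intro M hM
      refine (norm_recursion_le (hn j) (torusChar (u j) m) (a := a / u j) (b := b / u j)
        ?_ ?_ haj hbj M).trans ?_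
      · rw [torusChar_one_zero, ha, mul_div_assoc]
      · rw [torusChar_zero_one, hb, mul_div_assoc]
      have hMN : (M : ℝ) ≤ N j := by exact_mod_cast hM
      have e1 : 20 * √(u j : ℝ) * (|a / u j| + |b / u j|) = 20 * (√(1 / u j) * (|a| + |b|)) := by
        rw [abs_div, abs_div, abs_of_pos (hu0 j), ← add_div, Real.sqrt_div zero_le_one,
          Real.sqrt_one]
        have hs : √(u j : ℝ) ≠ 0 := (Real.sqrt_pos.2 (hu0 j)).ne'
        have hs2 : √(u j : ℝ) ^ 2 = u j := Real.sq_sqrt (hu0 j).le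
        have := (hu0 j).ne'
        field_simp
        rw [hs2, mul_comm]
      have e2 : (a / u j) ^ 2 + (b / u j) ^ 2 = (a ^ 2 + b ^ 2) / (u j) ^ 2 := by ring
      have e3 : √(u j * (40 * M / ((u j : ℝ) ^ 2 - 1) + 6400 * u j))
          ≤ (u j) ^ 2 * √(80 * (N j / (u j) ^ 4) * (1 / u j) + 6400 * (1 / u j) ^ 2) := by
        rw [Real.sqrt_le_left (by positivity), mul_pow, Real.sq_sqrt (by positivity)]
        have : 40 * (M : ℝ) / ((u j : ℝ) ^ 2 - 1) ≤ 80 * N j / (u j) ^ 2 := by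
          rw [div_le_div_iff₀ (by nlinarith) (by have := hu0 j; positivity)]
          have h0 : (0 : ℝ) ≤ M := Nat.cast_nonneg _
          have h9 : (9 : ℝ) ≤ (u j) ^ 2 := by nlinarith
          nlinarith
        have h5 := mul_le_mul_of_nonneg_left
          (add_le_add_left this (6400 * (u j : ℝ))) (hu0 j).le
        refine h5.trans (le_of_eq ?_)
        have := (hu0 j).ne'
        field_simp
      rw [e1, e2, hε]
      refine add_le_add le_rfl ?_
      rw [mul_assoc]
      refine mul_le_mul_of_nonneg_left ?_ (by norm_num)
      rw [div_mul_eq_mul_div, div_le_iff₀ (by have := hu0 j; positivity), mul_assoc]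
      refine mul_le_mul_of_nonneg_left ?_ (by positivity)
      rwa [mul_comm _ ((u j : ℝ) ^ 2)]
    refine (norm_sub_pow_le hrec le_rfl).trans ?_
    have hε' : 0 ≤ ε j := (norm_nonneg _).trans (hrec 0 (Nat.zero_le _))
    refine mul_le_mul_of_nonneg_left ?_ hε'
    rw [abs_mul, Nat.abs_cast, Real.exp_nat_mul]
    exact pow_le_pow_left₀ (by positivity) (by
      rw [add_comm]; exact Real.add_one_le_exp _) _
  have := hdiff.add ((Complex.continuous_ofReal.tendsto _).comp hpow)
  rw [zero_add] at this
  refine this.congr fun j => ?_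
  simp

end SinglePiece

namespace SinglePiece

open Filter Topology

/-- A summable family on `ℤ²` with exponential decay. -/
noncomputable def expDecay (c : ℝ) (m : ℤ × ℤ) : ℝ :=
  Real.exp (-c * |(m.1 : ℝ)|) * Real.exp (-c * |(m.2 : ℝ)|)

lemma expDecay_nonneg (c : ℝ) (m : ℤ × ℤ) : 0 ≤ expDecay c m := by
  unfold expDecay; positivity

lemma summable_expDecay {c : ℝ} (hc : 0 < c) : Summable (expDecay c) := by
  have hN : Summable fun k : ℕ => Real.exp (-c * k) := by
    have := Real.summable_exp_nat_mul_iff (a := -c)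
    simpa [mul_comm] using this.2 (by linarith)
  have hZ : Summable fun k : ℤ => Real.exp (-c * |(k : ℝ)|) :=
    Summable.of_nat_of_neg (by simpa using hN) (by simpa using hN)
  exact hZ.mul_of_nonneg hZ (fun _ => (Real.exp_pos _).le) (fun _ => (Real.exp_pos _).le)

lemma mul_div_le_norm_one_sub_exp {n : ℕ} (hn : 0 < n) {a : ℤ} (ha : 2 * |a| ≤ n) :
    4 * |(a : ℝ)| / n ≤ ‖1 - Complex.exp ((2 * Real.pi * (a / n) : ℝ) * Complex.I)‖ := by
  have hn0 : (0 : ℝ) < n := by exact_mod_cast hn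
  have ha' : 2 * |(a : ℝ)| ≤ n := by exact_mod_cast ha
  have hpi := Real.pi_pos
  rw [norm_sub_rev, mul_comm _ Complex.I, Complex.norm_exp_I_mul_ofReal_sub_one, norm_mul,
    Real.norm_two, Real.norm_eq_abs]
  have e : 2 * Real.pi * (a / n) / 2 = Real.pi * (a / n) := by ring
  have e1 : |Real.pi * ((a : ℝ) / n)| = Real.pi * (|(a : ℝ)| / n) := by
    rw [abs_mul, abs_div, abs_of_pos hpi, abs_of_pos hn0]
  have h2 : Real.pi * (|(a : ℝ)| / n) ≤ Real.pi / 2 := by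
    rw [div_eq_mul_one_div Real.pi 2]
    refine mul_le_mul_of_nonneg_left ?_ hpi.le
    rw [div_le_div_iff₀ hn0 two_pos]
    linarith
  have h := Real.mul_le_sin (x := Real.pi * (|(a : ℝ)| / n)) (by positivity) h2
  have e2 : |Real.sin (Real.pi * (a / n))| = Real.sin (Real.pi * (|(a : ℝ)| / n)) := by
    rw [← e1, Real.abs_sin_eq_sin_abs_of_abs_le_pi]
    rw [e1]; linarith
  rw [e, e2]
  calc 4 * |(a : ℝ)| / n = 2 * (2 / Real.pi * (Real.pi * (|(a : ℝ)| / n))) := by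
        field_simp; ring
    _ ≤ _ := by linarith

lemma one_sub_pow_le_exp {x : ℝ} (hx : x ≤ 1) (N : ℕ) : (1 - x) ^ N ≤ Real.exp (-(N * x)) := by
  have := pow_le_pow_left₀ (by linarith) (Real.one_sub_le_exp_neg x) N
  rwa [← Real.exp_nat_mul, mul_neg] at this

variable {u : ℕ → ℕ} [∀ j, NeZero (u j)]

lemma exists_norm_sum_pairTransform_le (hn : ∀ j, 3 ≤ u j) (hu : Tendsto u atTop atTop)
    {N : ℕ → ℕ} {τ : ℝ} (hτ : 0 < τ)
    (hN : Tendsto (fun j => (N j : ℝ) / (u j : ℝ) ^ 4) atTop (𝓝 τ)) :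
    ∃ c > 0, ∀ᶠ j in atTop, ∀ m : ℤ × ℤ, 2 * |m.1| ≤ u j → 2 * |m.2| ≤ u j →
      ‖∑ z, pairTransform (torusChar (u j) m) (N j) z‖ ≤ 3 * expDecay c m := by
  have huR : Tendsto (fun j => (u j : ℝ)) atTop atTop := tendsto_natCast_atTop_atTop.comp hu
  have hexp : Tendsto (fun j => (u j : ℝ) ^ 2 * Real.exp (-(τ / 51200) * u j)) atTop (𝓝 0) := by
    have := (Real.tendsto_pow_mul_exp_neg_atTop_nhds_zero 2).comp
      (huR.const_mul_atTop (by positivity : 0 < τ / 51200))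
    have h2 := this.const_mul ((51200 / τ) ^ 2)
    rw [mul_zero] at h2
    refine h2.congr fun j => ?_
    simp only [Function.comp]
    rw [neg_mul]
    field_simp
  refine ⟨τ / 102400, by positivity, ?_⟩
  filter_upwards [hN.eventually_const_lt (by linarith : τ / 2 < τ),
    hexp.eventually_lt_const zero_lt_one, huR.eventually_ge_atTop (8 / τ)] with j h1 h2 h3 m hm1 hm2
  have hn3 : (3 : ℝ) ≤ u j := by exact_mod_cast hn j
  have hu0 : (0 : ℝ) < u j := by linarith
  set n : ℝ := (u j : ℝ) with hn'
  rw [lt_div_iff₀ (by positivity)] at h1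
  have h4 : 1 ≤ τ / 8 * n ^ 4 := by
    have : 1 ≤ n ^ 3 := one_le_pow₀ (by linarith)
    rw [div_le_iff₀ hτ] at h3
    nlinarith [mul_le_mul h3 this (by norm_num) (by positivity)]
  set k : ℝ := max |(m.1 : ℝ)| |(m.2 : ℝ)| with hk
  have hkdef : ∃ i : ℤ, k = |(i : ℝ)| ∧ 2 * |i| ≤ u j ∧ ∃ d, (d = (1, 0) ∨ d = (0, 1)) ∧
      torusChar (u j) m d = Complex.exp ((2 * Real.pi * (i / u j) : ℝ) * Complex.I) := by
    rcases max_choice |(m.1 : ℝ)| |(m.2 : ℝ)| with h | h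
    · exact ⟨m.1, hk.trans h, hm1, (1, 0), Or.inl rfl, torusChar_one_zero _ _⟩
    · exact ⟨m.2, hk.trans h, hm2, (0, 1), Or.inr rfl, torusChar_zero_one _ _⟩
  obtain ⟨i, hki, hi, d, hd, hχd⟩ := hkdef
  have hk0 : 0 ≤ k := by rw [hki]; positivity
  have hkn : k ≤ n := by
    have : 2 * |(i : ℝ)| ≤ u j := by exact_mod_cast hi
    rw [hki]; linarith [abs_nonneg (i : ℝ)]
  have hkk : k ≤ k ^ 2 := by
    have : |i| ≤ |i| ^ 2 := Int.le_self_sq _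
    rw [hki]; exact_mod_cast this
  have hχ : 4 * k / (u j : ℝ) ≤ ‖1 - torusChar (u j) m d‖ := by
    rw [hχd, hki]
    exact mul_div_le_norm_one_sub_exp (by have := hn j; omega) hi
  have key := norm_sum_pairTransform_sq_le (hn j) (torusChar (u j) m) hd hk0 hkn hkk hχ
    (N j / 2) (N j - N j / 2)
  rw [Nat.add_sub_cancel' (Nat.div_le_self _ _), ← hn'] at key
  have hM1 : τ / 8 * n ^ 4 ≤ ((N j / 2 : ℕ) : ℝ) := by
    have : N j ≤ 2 * (N j / 2) + 1 := by omega
    have : (N j : ℝ) ≤ 2 * ((N j / 2 : ℕ) : ℝ) + 1 := by exact_mod_cast this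
    linarith
  have hM2 : τ / 4 * n ^ 4 ≤ ((N j - N j / 2 : ℕ) : ℝ) := by
    have : N j ≤ 2 * (N j - N j / 2) := by omega
    have : (N j : ℝ) ≤ 2 * ((N j - N j / 2 : ℕ) : ℝ) := by exact_mod_cast this
    linarith
  have hn3' : 1 ≤ n ^ 3 := one_le_pow₀ (by linarith)
  have b1 : (1 - k / (6400 * n ^ 4)) ^ (N j - N j / 2) ≤ Real.exp (-(τ / 25600 * k)) := by
    refine (one_sub_pow_le_exp ?_ _).trans (Real.exp_le_exp.2 ?_)
    · rw [div_le_one (by positivity)]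
      nlinarith
    · rw [neg_le_neg_iff]
      calc τ / 25600 * k = τ / 4 * n ^ 4 * (k / (6400 * n ^ 4)) := by field_simp; ring
        _ ≤ _ := by gcongr
  have b2 : (1 - 1 / (6400 * n ^ 3)) ^ (N j / 2) ≤ Real.exp (-(τ / 51200) * n) := by
    refine (one_sub_pow_le_exp ?_ _).trans (Real.exp_le_exp.2 ?_)
    · rw [div_le_one (by positivity)]
      linarith
    · rw [neg_mul, neg_le_neg_iff]
      calc τ / 51200 * n = τ / 8 * n ^ 4 * (1 / (6400 * n ^ 3)) := by field_simp; norm_num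
        _ ≤ _ := by gcongr
  have b3 : 4 + n ^ 2 * (1 - 1 / (6400 * n ^ 3)) ^ (N j / 2) ≤ 5 := by
    have := mul_le_mul_of_nonneg_left b2 (sq_nonneg n)
    linarith
  have b4 : 0 ≤ (1 - 1 / (6400 * n ^ 3)) ^ (N j / 2) := by
    apply pow_nonneg
    rw [sub_nonneg, div_le_one (by positivity)]
    linarith
  have fin : ‖∑ z, pairTransform (torusChar (u j) m) (N j) z‖ ^ 2
      ≤ (3 * Real.exp (-(τ / 51200 * k))) ^ 2 := by
    refine key.trans ((mul_le_mul b1 b3 (by positivity) (Real.exp_pos _).le).trans ?_)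
    rw [mul_pow, ← Real.exp_nat_mul]
    have : ((2 : ℕ) : ℝ) * -(τ / 51200 * k) = -(τ / 25600 * k) := by push_cast; ring
    rw [this]
    nlinarith [Real.exp_pos (-(τ / 25600 * k))]
  refine ((sq_le_sq₀ (norm_nonneg _) (by positivity)).1 fin).trans ?_
  rw [expDecay, ← Real.exp_add]
  gcongr
  have := le_max_left |(m.1 : ℝ)| |(m.2 : ℝ)|
  have := le_max_right |(m.1 : ℝ)| |(m.2 : ℝ)|
  nlinarith

end SinglePiece

namespace SinglePiece

open Filter Topology

/-- The frequencies that represent the characters of the discrete torus of side `n`. -/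
def freqBox (n : ℕ) : Set (ℤ × ℤ) :=
  {m | m.1 * 2 ∈ Set.Ioc (-(n : ℤ)) n ∧ m.2 * 2 ∈ Set.Ioc (-(n : ℤ)) n}

lemma two_mul_abs_le_of_mem_freqBox {n : ℕ} {m : ℤ × ℤ} (hm : m ∈ freqBox n) :
    2 * |m.1| ≤ n ∧ 2 * |m.2| ≤ n := by
  obtain ⟨⟨h1, h2⟩, h3, h4⟩ := hm
  constructor <;> cases abs_cases m.1 <;> cases abs_cases m.2 <;> omega

lemma eventually_mem_freqBox {u : ℕ → ℕ} (hu : Tendsto u atTop atTop) (m : ℤ × ℤ) :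
    ∀ᶠ j in atTop, m ∈ freqBox (u j) := by
  filter_upwards [hu.eventually_ge_atTop (2 * m.1.natAbs + 2 * m.2.natAbs + 1)] with j hj
  refine ⟨⟨?_, ?_⟩, ?_, ?_⟩ <;> omega

lemma tsum_indicator_freqBox (n : ℕ) [NeZero n] (g : ℤ × ℤ → ℝ) :
    ∑' m, (freqBox n).indicator g m
      = ∑ k : ZMod n × ZMod n, g (k.1.valMinAbs, k.2.valMinAbs) := by
  classical
  have hinj : Function.Injective
      (fun k : ZMod n × ZMod n => ((k.1.valMinAbs, k.2.valMinAbs) : ℤ × ℤ)) := fun a b h =>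
    Prod.ext (ZMod.injective_valMinAbs (congrArg Prod.fst h))
      (ZMod.injective_valMinAbs (congrArg Prod.snd h))
  rw [tsum_eq_sum (s := univ.image fun k : ZMod n × ZMod n =>
    ((k.1.valMinAbs, k.2.valMinAbs) : ℤ × ℤ)), sum_image hinj.injOn]
  · refine sum_congr rfl fun k _ => Set.indicator_of_mem ?_ _
    exact ⟨ZMod.valMinAbs_mem_Ioc _, ZMod.valMinAbs_mem_Ioc _⟩
  · intro m hm
    refine Set.indicator_of_notMem (fun h => hm ?_) _
    refine mem_image.2 ⟨((m.1 : ZMod n), (m.2 : ZMod n)), mem_univ _, Prod.ext ?_ ?_⟩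
    · exact (ZMod.valMinAbs_spec _ _).2 ⟨rfl, h.1⟩
    · exact (ZMod.valMinAbs_spec _ _).2 ⟨rfl, h.2⟩

lemma sq_mul_pieceDist_eq (n : ℕ) [NeZero n] (N : ℕ) (y : ZMod n × ZMod n) :
    (n : ℝ) ^ 2 * pieceDist n N y = ∑' m, (freqBox n).indicator (fun m =>
      ((∑ z, pairTransform (torusChar n m) N z) * torusChar n m (-y)).re) m := by
  classical
  rw [tsum_indicator_freqBox, ← Complex.re_sum]
  have h : ∀ k : ZMod n × ZMod n,
      (∑ z, pairTransform (torusChar n (k.1.valMinAbs, k.2.valMinAbs)) N z)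
        * torusChar n (k.1.valMinAbs, k.2.valMinAbs) (-y)
      = ∑ σ : Equiv.Perm (ZMod n × ZMod n), (puzzleDist n N σ : ℂ) *
        ZMod.stdAddChar (k.1 * (σ 0 - y).1 + k.2 * (σ 0 - y).2) := by
    intro k
    rw [sum_pairTransform, sum_mul]
    refine sum_congr rfl fun σ _ => ?_
    rw [mul_assoc, ← AddChar.map_add_eq_mul, torusChar_apply, ← sub_eq_add_neg]
    simp only [ZMod.coe_valMinAbs]
  simp only [h]
  rw [sum_comm]
  simp only [← mul_sum, sum_stdAddChar_mul, sub_eq_zero]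
  rw [pieceDist, mul_sum, Complex.re_sum]
  refine sum_congr rfl fun σ _ => ?_
  rw [← Prod.zero_eq_mk]
  split_ifs
  · rw [← Complex.ofReal_natCast, ← Complex.ofReal_pow, ← Complex.ofReal_mul, Complex.ofReal_re,
      mul_comm]
  · simp

lemma torusChar_neg_gridPoint (n : ℕ) [NeZero n] (m : ℤ × ℤ) (x : ℝ × ℝ) :
    torusChar n m (-gridPoint n x) = Complex.exp ((-(2 * Real.pi *
      (m.1 * ((⌊(n : ℝ) * x.1⌋ : ℝ) / n) + m.2 * ((⌊(n : ℝ) * x.2⌋ : ℝ) / n))) : ℝ)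
        * Complex.I) := by
  have h := stdAddChar_intCast_eq n (-(m.1 * ⌊(n : ℝ) * x.1⌋ + m.2 * ⌊(n : ℝ) * x.2⌋))
  rw [torusChar_apply]
  have e : (m.1 : ZMod n) * (-gridPoint n x).1 + (m.2 : ZMod n) * (-gridPoint n x).2
      = ((-(m.1 * ⌊(n : ℝ) * x.1⌋ + m.2 * ⌊(n : ℝ) * x.2⌋) : ℤ) : ZMod n) := by
    simp only [gridPoint, Prod.fst_neg, Prod.snd_neg]
    push_cast
    ring
  rw [e, h]
  congr 3
  push_cast
  ring

lemma norm_torusChar (n : ℕ) [NeZero n] (m : ℤ × ℤ) (y : ZMod n × ZMod n) :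
    ‖torusChar n m y‖ = 1 := AddChar.norm_apply _ _

lemma cPuz_pos : 0 < cPuz := by
  unfold cPuz
  linarith [Real.pi_gt_three]

variable {u : ℕ → ℕ} [∀ j, NeZero (u j)]

lemma tendsto_sq_mul_pieceDist (hn : ∀ j, 3 ≤ u j) (hu : Tendsto u atTop atTop)
    {N : ℕ → ℕ} {t : ℝ} (hN : Tendsto (fun j => (N j : ℝ) / (u j : ℝ) ^ 4) atTop (𝓝 (cPuz * t)))
    {c : ℝ} (hc : 0 < c)
    (hb : ∀ᶠ j in atTop, ∀ m : ℤ × ℤ, 2 * |m.1| ≤ u j → 2 * |m.2| ≤ u j →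
      ‖∑ z, pairTransform (torusChar (u j) m) (N j) z‖ ≤ 3 * expDecay c m) (x : ℝ × ℝ) :
    Tendsto (fun j => (u j : ℝ) ^ 2 * pieceDist (u j) (N j) (gridPoint (u j) x)) atTop
      (𝓝 (torusHeatKernel t x)) := by
  simp only [sq_mul_pieceDist_eq]
  refine tendsto_tsum_of_dominated_convergence ((summable_expDecay hc).mul_left 3)
    (fun m => ?_) ?_
  · refine Tendsto.congr' (f₁ := fun j =>
      ((∑ z, pairTransform (torusChar (u j) m) (N j) z)
        * torusChar (u j) m (-gridPoint (u j) x)).re) ?_ ?_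
    · filter_upwards [eventually_mem_freqBox hu m] with j hj
      rw [Set.indicator_of_mem hj]
    · have h1 := tendsto_sum_pairTransform hn hu hN m
      have hf : ∀ s : ℝ, Tendsto (fun j => (⌊(u j : ℝ) * s⌋ : ℝ) / u j) atTop (𝓝 s) := fun s =>
        (tendsto_floor_mul_div s).comp hu
      have h2 : Tendsto (fun j => torusChar (u j) m (-gridPoint (u j) x)) atTop
          (𝓝 (Complex.exp ((-(2 * Real.pi * (m.1 * x.1 + m.2 * x.2)) : ℝ) * Complex.I))) := by
        simp only [torusChar_neg_gridPoint]
        refine (Complex.continuous_exp.tendsto _).comp (Tendsto.mul_const _ ?_)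
        refine (Complex.continuous_ofReal.tendsto _).comp (Tendsto.neg (Tendsto.const_mul _ ?_))
        exact ((hf x.1).const_mul _).add ((hf x.2).const_mul _)
      have h3 := (Complex.continuous_re.tendsto _).comp (h1.mul h2)
      refine h3.congr' (Eventually.of_forall fun _ => rfl) |>.trans (le_of_eq (congrArg 𝓝 ?_))
      rw [Complex.re_ofReal_mul, Complex.exp_ofReal_mul_I_re, Real.cos_neg]
      congr 2
      have := cPuz_pos.ne'
      field_simp
  · filter_upwards [hb] with j hj m
    by_cases hm : m ∈ freqBox (u j)
    · rw [Set.indicator_of_mem hm, Real.norm_eq_abs]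
      refine (Complex.abs_re_le_norm _).trans ?_
      rw [norm_mul, norm_torusChar, mul_one]
      exact hj m (two_mul_abs_le_of_mem_freqBox hm).1 (two_mul_abs_le_of_mem_freqBox hm).2
    · rw [Set.indicator_of_notMem hm, norm_zero]
      have := expDecay_nonneg c m
      positivity

lemma abs_sq_mul_pieceDist_le {n N : ℕ} [NeZero n] {c : ℝ} (hc : 0 < c)
    (hb : ∀ m : ℤ × ℤ, 2 * |m.1| ≤ n → 2 * |m.2| ≤ n →
      ‖∑ z, pairTransform (torusChar n m) N z‖ ≤ 3 * expDecay c m) (y : ZMod n × ZMod n) :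
    |(n : ℝ) ^ 2 * pieceDist n N y| ≤ ∑' m, 3 * expDecay c m := by
  rw [sq_mul_pieceDist_eq, ← Real.norm_eq_abs]
  refine tsum_of_norm_bounded ((summable_expDecay hc).mul_left 3).hasSum fun m => ?_
  by_cases hm : m ∈ freqBox n
  · rw [Set.indicator_of_mem hm, Real.norm_eq_abs]
    refine (Complex.abs_re_le_norm _).trans ?_
    rw [norm_mul, norm_torusChar, mul_one]
    exact hb m (two_mul_abs_le_of_mem_freqBox hm).1 (two_mul_abs_le_of_mem_freqBox hm).2
  · rw [Set.indicator_of_notMem hm, norm_zero]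
    have := expDecay_nonneg c m
    positivity

lemma pieceTV_eq_integral (n : ℕ) [NeZero n] (N : ℕ) :
    pieceTV n N = (1 / 2) * ∫ x in Set.Icc (0 : ℝ) 1 ×ˢ Set.Icc (0 : ℝ) 1,
      |(n : ℝ) ^ 2 * pieceDist n N (gridPoint n x) - 1| := by
  have hn0 : (0 : ℝ) < n := by exact_mod_cast Nat.pos_of_ne_zero (NeZero.ne n)
  rw [pieceTV, setIntegral_gridPoint_comp n fun y => |(n : ℝ) ^ 2 * pieceDist n N y - 1|]
  congr 1
  rw [mul_sum]
  refine Finset.sum_congr rfl fun y _ => ?_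
  rw [show (1 : ℝ) / (n : ℝ) ^ 2 = |(1 : ℝ) / (n : ℝ) ^ 2| from (abs_of_pos (by positivity)).symm,
    ← abs_mul, abs_of_pos (by positivity : (0 : ℝ) < 1 / (n : ℝ) ^ 2)]
  congr 1
  field_simp

lemma tendsto_pieceTV (hn : ∀ j, 3 ≤ u j) (hu : Tendsto u atTop atTop)
    {N : ℕ → ℕ} {t : ℝ} (ht : 0 < t)
    (hN : Tendsto (fun j => (N j : ℝ) / (u j : ℝ) ^ 4) atTop (𝓝 (cPuz * t))) :
    Tendsto (fun j => pieceTV (u j) (N j)) atTop (𝓝 (dBr t)) := by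
  obtain ⟨c, hc, hb⟩ := exists_norm_sum_pairTransform_le hn hu (mul_pos cPuz_pos ht) hN
  simp only [pieceTV_eq_integral, dBr]
  refine Tendsto.const_mul _ ?_
  refine tendsto_integral_filter_of_dominated_convergence
    (fun _ => (∑' m, 3 * expDecay c m) + 1) ?_ ?_ ?_ ?_
  · refine Eventually.of_forall fun j => ?_
    exact (integrableOn_gridPoint_comp (u j) fun y =>
      |(u j : ℝ) ^ 2 * pieceDist (u j) (N j) y - 1|).aestronglyMeasurable
  · filter_upwards [hb] with j hj
    refine Eventually.of_forall fun x => ?_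
    rw [Real.norm_eq_abs, abs_abs]
    refine (abs_sub _ _).trans ?_
    rw [abs_one]
    gcongr
    exact abs_sq_mul_pieceDist_le hc hj _
  · exact integrableOn_const (isCompact_Icc.prod isCompact_Icc).measure_lt_top.ne
  · refine Eventually.of_forall fun x => ?_
    exact ((tendsto_sq_mul_pieceDist hn hu hN hc hb x).sub_const 1).abs

lemma heatKernel_term_le {a t : ℝ} (ha : 0 < a) (hat : a ≤ t) (m : ℤ × ℤ) (y : ℝ) :
    ‖Real.exp (-2 * Real.pi ^ 2 * t * ((m.1 : ℝ) ^ 2 + (m.2 : ℝ) ^ 2)) * Real.cos y‖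
      ≤ expDecay (2 * Real.pi ^ 2 * a) m := by
  have hk : ∀ i : ℤ, |(i : ℝ)| ≤ (i : ℝ) ^ 2 := fun i => by
    rw [← sq_abs]
    exact_mod_cast Int.le_self_sq |i|
  rw [norm_mul, Real.norm_eq_abs, Real.norm_eq_abs, Real.abs_exp, expDecay, ← Real.exp_add]
  refine (mul_le_of_le_one_right (Real.exp_pos _).le (Real.abs_cos_le_one _)).trans ?_
  rw [Real.exp_le_exp]
  have h1 : 2 * Real.pi ^ 2 * a * (|(m.1 : ℝ)| + |(m.2 : ℝ)|)
      ≤ 2 * Real.pi ^ 2 * t * ((m.1 : ℝ) ^ 2 + (m.2 : ℝ) ^ 2) := by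
    have := hk m.1
    have := hk m.2
    have := ha.trans_le hat
    gcongr
  linarith

lemma continuous_torusHeatKernel {t : ℝ} (ht : 0 < t) : Continuous (torusHeatKernel t) := by
  unfold torusHeatKernel
  refine continuous_tsum (fun m => by fun_prop)
    (summable_expDecay (c := 2 * Real.pi ^ 2 * t) (by positivity)) fun m x => ?_
  exact heatKernel_term_le ht le_rfl m _

lemma tendsto_dBr {t : ℕ → ℝ} {t₀ : ℝ} (ht₀ : 0 < t₀) (ht : Tendsto t atTop (𝓝 t₀)) :
    Tendsto (fun j => dBr (t j)) atTop (𝓝 (dBr t₀)) := by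
  have hev := ht.eventually_const_le (half_lt_self ht₀)
  have hs : Summable (expDecay (2 * Real.pi ^ 2 * (t₀ / 2))) := summable_expDecay (by positivity)
  simp only [dBr]
  refine Tendsto.const_mul _ ?_
  refine tendsto_integral_filter_of_dominated_convergence
    (fun _ => (∑' m, expDecay (2 * Real.pi ^ 2 * (t₀ / 2)) m) + 1) ?_ ?_ ?_ ?_
  · filter_upwards [hev] with j hj
    exact ((continuous_torusHeatKernel (by linarith)).sub
      continuous_const).abs.aestronglyMeasurable
  · filter_upwards [hev] with j hj
    refine Eventually.of_forall fun x => ?_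
    rw [Real.norm_eq_abs, abs_abs]
    refine (abs_sub _ _).trans ?_
    rw [abs_one]
    gcongr
    exact tsum_of_norm_bounded hs.hasSum fun m => heatKernel_term_le (by linarith) hj m _
  · exact integrableOn_const (isCompact_Icc.prod isCompact_Icc).measure_lt_top.ne
  · refine Eventually.of_forall fun x => ?_
    refine Tendsto.abs (Tendsto.sub_const ?_ 1)
    refine tendsto_tsum_of_dominated_convergence hs (fun m => ?_) ?_
    · refine Tendsto.mul_const _ ((Real.continuous_exp.tendsto _).comp ?_)
      exact (ht.const_mul _).mul_const _
    · filter_upwards [hev] with j hj m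
      exact heatKernel_term_le (by linarith) hj m _

lemma tendsto_floor_div_pow (hu : Tendsto u atTop atTop) {t : ℕ → ℝ} {t₀ : ℝ} (ht₀ : 0 < t₀)
    (ht : Tendsto t atTop (𝓝 t₀)) :
    Tendsto (fun j => (⌊cPuz * (u j : ℝ) ^ 4 * t j⌋₊ : ℝ) / (u j : ℝ) ^ 4) atTop
      (𝓝 (cPuz * t₀)) := by
  have huR : Tendsto (fun j => (u j : ℝ) ^ 4) atTop atTop :=
    (tendsto_pow_atTop (by norm_num)).comp (tendsto_natCast_atTop_atTop.comp hu)
  have h1 : Tendsto (fun j => cPuz * t j) atTop (𝓝 (cPuz * t₀)) := ht.const_mul _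
  have h2 := h1.sub (tendsto_inv_atTop_zero.comp huR)
  rw [sub_zero] at h2
  refine tendsto_of_tendsto_of_tendsto_of_le_of_le' h2 h1 ?_ ?_
  · refine Eventually.of_forall fun j => ?_
    have hu0 : (0 : ℝ) < u j := by exact_mod_cast Nat.pos_of_ne_zero (NeZero.ne (u j))
    have := Nat.lt_floor_add_one (cPuz * (u j : ℝ) ^ 4 * t j)
    simp only [Function.comp]
    rw [le_div_iff₀ (by positivity), sub_mul, inv_mul_cancel₀ (by positivity)]
    linarith
  · filter_upwards [ht.eventually_const_lt ht₀] with j hj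
    have hu0 : (0 : ℝ) < u j := by exact_mod_cast Nat.pos_of_ne_zero (NeZero.ne (u j))
    have := Nat.floor_le (a := cPuz * (u j : ℝ) ^ 4 * t j)
      (by have := cPuz_pos; positivity)
    rw [div_le_iff₀ (by positivity)]
    linarith

end SinglePiece

/-- **Mixing of a single piece in the `n²−1` puzzle.**  The total variation distance to
uniformity of a single piece after `⌊c_puz n⁴ t⌋` steps converges to `d_Br(t)`, uniformly
for `t` in compact subsets of `(0,∞)`. -/
theorem single_piece_mixing :
    ∀ K : Set ℝ, IsCompact K → K ⊆ Set.Ioi 0 →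
      ∀ ε : ℝ, 0 < ε → ∃ n₀ : ℕ, ∀ (n : ℕ) [NeZero n], 3 ≤ n → n₀ ≤ n →
        ∀ t ∈ K, |pieceTV n ⌊cPuz * (n : ℝ) ^ 4 * t⌋₊ - dBr t| < ε := by
  intro K hK hK0 ε hε
  by_contra! h
  choose u inst hu3 hu t htK hbad using h
  obtain ⟨t₀, ht₀, φ, hφ, hlim⟩ := hK.tendsto_subseq htK
  have hpos : 0 < t₀ := hK0 ht₀
  have huφ : Filter.Tendsto (u ∘ φ) Filter.atTop Filter.atTop :=
    (Filter.tendsto_atTop_mono hu Filter.tendsto_id).comp hφ.tendsto_atTop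
  have : ∀ j, NeZero ((u ∘ φ) j) := fun j => inst (φ j)
  have h1 := SinglePiece.tendsto_pieceTV (fun j => hu3 (φ j)) huφ hpos
    (SinglePiece.tendsto_floor_div_pow huφ hpos hlim)
  have h2 := (h1.sub (SinglePiece.tendsto_dBr hpos hlim)).abs
  rw [sub_self, abs_zero] at h2
  obtain ⟨j, hj⟩ := (h2.eventually_lt_const hε).exists
  exact absurd hj (hbad (φ j)).not_gt
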